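/- arXiv:math/0407260 — 3 statements merged into one kernel-verified Lean document; each statement's English description precedes it below -/
import Mathlib

section
/- For every positive integer n and all real numbers t_1, ..., t_n in (0, ∞), the function Φ_n is concave on the interval (-1/2, 1/2). -/
open MeasureTheory Real

/-- The one-dimensional Gaussian density `p_t(x) = (2πt)^{-1/2} exp(-x²/(2t))`. -/
noncomputable def gaussDensity (t x : ℝ) : ℝ :=
  (Real.sqrt (2 * Real.pi * t))⁻¹ * Real.exp (-x ^ 2 / (2 * t))

/-- `Φ_n(x) = ∫_{-1}^{1} ⋯ ∫_{-1}^{1} ∏_{i=1}^{n} p_{t_i}(x_{i-1} - x_i) dx_1 ⋯ dx_n`,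
with `x_0 = x`. -/
noncomputable def Phi (n : ℕ) (t : Fin n → ℝ) (x : ℝ) : ℝ :=
  ∫ y in Set.Icc (fun _ : Fin n => (-1 : ℝ)) (fun _ : Fin n => (1 : ℝ)),
    ∏ i : Fin n,
      gaussDensity (t i) ((Fin.cons x y : Fin (n + 1) → ℝ) i.castSucc - (Fin.cons x y : Fin (n + 1) → ℝ) i.succ)

open Set

theorem hasDerivAt_integral_sub_mul {q q' f : ℝ → ℝ} (hq : ∀ x, HasDerivAt q (q' x) x)
    (hq' : Continuous q') (hf : Continuous f) (a b x : ℝ) :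
    HasDerivAt (fun x => ∫ y in a..b, q (x - y) * f y) (∫ y in a..b, q' (x - y) * f y) x := by
  have hqc : Continuous q := continuous_iff_continuousAt.2 fun x => (hq x).continuousAt
  obtain ⟨C, hC⟩ := ((isCompact_closedBall x 1).prod (isCompact_uIcc (a := a) (b := b))
    ).exists_bound_of_continuousOn (f := fun z : ℝ × ℝ => q' (z.1 - z.2) * f z.2)
      (by fun_prop)
  refine (intervalIntegral.hasDerivAt_integral_of_dominated_loc_of_deriv_le
    (F := fun x y => q (x - y) * f y) (F' := fun x y => q' (x - y) * f y) (bound := fun _ => C)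
    (Metric.closedBall_mem_nhds x one_pos) (.of_forall fun x => ?_) ?_ ?_ ?_ ?_ ?_).2
  · exact Continuous.aestronglyMeasurable (by fun_prop)
  · exact Continuous.intervalIntegrable (by fun_prop) _ _
  · exact Continuous.aestronglyMeasurable (by fun_prop)
  · exact .of_forall fun y hy z hz => hC (z, y) ⟨hz, uIoc_subset_uIcc hy⟩
  · simp
  · exact .of_forall fun y _ z _ => ((hq (z - y)).comp_sub_const z y).mul_const _

theorem contDiff_integral_sub_mul (n : ℕ) {q f : ℝ → ℝ} (hq : ContDiff ℝ n q)
    (hf : Continuous f) (a b : ℝ) :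
    ContDiff ℝ n (fun x => ∫ y in a..b, q (x - y) * f y) := by
  induction n generalizing q with
  | zero =>
    have := hq.continuous
    exact contDiff_zero.2 (intervalIntegral.continuous_parametric_intervalIntegral_of_continuous'
      (by fun_prop) _ _)
  | succ n ih =>
    have h := (contDiff_succ_iff_deriv (n := (n : WithTop ℕ∞))).1 (by exact_mod_cast hq)
    have key := hasDerivAt_integral_sub_mul (fun x => (h.1 x).hasDerivAt) h.2.2.continuous hf a b
    have : ContDiff ℝ ((n : WithTop ℕ∞) + 1) (fun x => ∫ y in a..b, q (x - y) * f y) := by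
      refine contDiff_succ_iff_deriv.2 ⟨fun x => (key x).differentiableAt, by simp, ?_⟩
      rw [show deriv (fun x => ∫ y in a..b, q (x - y) * f y) = _ from funext fun x => (key x).deriv]
      exact ih h.2.2
    exact_mod_cast this

/-- The integral of `g * m` over `[a, b]` is nonnegative when `g` is increasing with `0 ≤ g a` and
all tail integrals of `m` are nonnegative. -/
theorem integral_mul_nonneg_of_tail_nonneg {g m : ℝ → ℝ} {a b : ℝ} (hab : a ≤ b)
    (hg : ContDiff ℝ 1 g) (hmono : MonotoneOn g (Icc a b)) (hga : 0 ≤ g a) (hm : Continuous m)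
    (htail : ∀ c ∈ Icc a b, 0 ≤ ∫ y in c..b, m y) :
    0 ≤ ∫ y in a..b, g y * m y := by
  have hv : ∀ x, HasDerivAt (fun c => ∫ y in b..c, m y) (m x) x := fun x =>
    intervalIntegral.integral_hasDerivAt_right (hm.intervalIntegrable _ _)
      (hm.stronglyMeasurableAtFilter _ _) hm.continuousAt
  have hg' : Continuous (deriv g) := hg.continuous_deriv le_rfl
  rw [intervalIntegral.integral_mul_deriv_eq_deriv_mul
    (fun x _ => ((hg.differentiable one_ne_zero) x).hasDerivAt)
    (fun x _ => hv x) (hg'.intervalIntegrable _ _) (hm.intervalIntegrable _ _)]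
  have h1 : 0 ≤ g a * ∫ y in a..b, m y := mul_nonneg hga (htail a ⟨le_rfl, hab⟩)
  have h2 : 0 ≤ ∫ x in a..b, -(deriv g x * ∫ y in b..x, m y) := by
    refine intervalIntegral.integral_nonneg_of_ae_restrict hab ?_
    rw [Measure.restrict_congr_set Ioo_ae_eq_Icc.symm]
    refine (ae_restrict_iff' measurableSet_Ioo).2 (.of_forall fun x hx => ?_)
    have hd : 0 ≤ deriv g x := by
      rw [← derivWithin_of_mem_nhds (Icc_mem_nhds hx.1 hx.2)]
      exact hmono.derivWithin_nonneg
    have := mul_nonneg hd (htail x (Ioo_subset_Icc_self hx))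
    simp only [intervalIntegral.integral_symm x b, mul_neg, neg_neg]
    exact this
  rw [intervalIntegral.integral_neg] at h2
  rw [intervalIntegral.integral_symm a b]
  simp only [intervalIntegral.integral_same, mul_zero, mul_neg, zero_sub, neg_neg]
  linarith

/-- A weighted integral over `[0, 1]` is nonnegative when the integral of `l` over every interval
centred at `1 / 2` is, `l` is nonnegative on the right half, and the weight `g` vanishes at `0`,
increases on the left half, and dominates there its reflection about `1 / 2`. -/
theorem integral_mul_nonneg_of_centred {g l : ℝ → ℝ} (hg : ContDiff ℝ 1 g) (hg0 : g 0 = 0)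
    (hmono : MonotoneOn g (Icc 0 (1 / 2))) (hrefl : ∀ y ∈ Icc (0 : ℝ) (1 / 2), g y ≤ g (1 - y))
    (hl : Continuous l) (hright : ∀ y ∈ Icc (1 / 2 : ℝ) 1, 0 ≤ l y)
    (hcentred : ∀ c ∈ Icc (0 : ℝ) (1 / 2), 0 ≤ ∫ y in c..(1 - c), l y) :
    0 ≤ ∫ y in (0 : ℝ)..1, g y * l y := by
  have hgc : Continuous g := hg.continuous
  have hii : ∀ {u : ℝ → ℝ} {a b : ℝ}, Continuous u → IntervalIntegrable u volume a b :=
    fun h => h.intervalIntegrable _ _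
  have fold : ∀ {u : ℝ → ℝ} (c : ℝ), Continuous u →
      ∫ y in c..(1 - c), u y = ∫ y in c..(1 / 2), (u y + u (1 - y)) := by
    intro u c hu
    rw [intervalIntegral.integral_add (hii hu) (hii (by fun_prop)),
      intervalIntegral.integral_comp_sub_left u 1,
      ← intervalIntegral.integral_add_adjacent_intervals (hii hu : IntervalIntegrable u volume c (1 / 2))
        (hii hu)]
    norm_num
  have h1 : 0 ≤ ∫ y in (0 : ℝ)..(1 / 2), g y * (l y + l (1 - y)) :=
    integral_mul_nonneg_of_tail_nonneg (by norm_num) hg hmono hg0.ge (by fun_prop) fun c hc => by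
      rw [← fold c hl]
      exact hcentred c hc
  have h2 : 0 ≤ ∫ y in (0 : ℝ)..(1 / 2), (g (1 - y) - g y) * l (1 - y) :=
    intervalIntegral.integral_nonneg (by norm_num) fun y hy =>
      mul_nonneg (sub_nonneg.2 (hrefl y hy))
        (hright _ ⟨by linarith [hy.2], by linarith [hy.1]⟩)
  have h3 := fold (u := fun y => g y * l y) 0 (by fun_prop)
  rw [sub_zero] at h3
  rw [h3]
  refine (add_nonneg h1 h2).trans_eq ?_
  rw [← intervalIntegral.integral_add (hii (by fun_prop)) (hii (by fun_prop))]
  congr 1 with y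
  ring

section Kernel

variable {p : ℝ → ℝ}

theorem integral_centred_le_of_radial_antitone (hpc : Continuous p)
    (hp : ∀ u v, |u| ≤ |v| → p v ≤ p u) {a b c : ℝ} (hab : a ≤ b)
    (hab1 : a + b ≤ 1) (hc : c ≤ 1 / 2) :
    ∫ y in c..(1 - c), p (a - y) ≤ ∫ y in c..(1 - c), p (b - y) := by
  have half : ∀ d, a ≤ d → d ≤ 1 / 2 →
      ∫ y in c..(1 - c), p (a - y) ≤ ∫ y in c..(1 - c), p (d - y) := by
    intro d had hd
    have hii : ∀ {u : ℝ → ℝ} {a b : ℝ}, Continuous u → IntervalIntegrable u volume a b :=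
      fun h => h.intervalIntegrable _ _
    rw [intervalIntegral.integral_comp_sub_left p, intervalIntegral.integral_comp_sub_left p,
      ← sub_nonneg, intervalIntegral.integral_interval_sub_interval_comm' (hii hpc) (hii hpc)
        (hii hpc),
      ← intervalIntegral.integral_comp_sub_right p c,
      ← intervalIntegral.integral_comp_sub_right p (1 - c), sub_nonneg]
    refine intervalIntegral.integral_mono_on had (hii (by fun_prop)) (hii (by fun_prop))
      fun s hs => hp _ _ ?_
    rw [abs_of_nonpos (by linarith [hs.2] : s - (1 - c) ≤ 0), abs_le]
    constructor <;> linarith [hs.1, hs.2]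
  rcases le_total b (1 / 2) with hb | hb
  · exact half b hab hb
  · refine (half (1 - b) (by linarith) (by linarith)).trans_eq ?_
    have h := intervalIntegral.integral_comp_sub_left (a := c) (b := 1 - c) (fun y => p (b - y)) 1
    rw [sub_sub_cancel] at h
    rw [← h]
    congr 1 with y
    have he : |b - (1 - y)| = |1 - b - y| := by rw [← abs_neg]; ring_nf
    exact le_antisymm (hp _ _ he.le) (hp _ _ he.ge)

/-- Even functions, nonnegative on `[-1, 1]`, whose derivative on `[0, 1]` is antitone on
`[0, 1 / 2]` and at `y ≤ 1 / 2` is at least as large as at `1 - y`. -/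
structure IsMidConcave (f : ℝ → ℝ) : Prop where
  contDiff : ContDiff ℝ 2 f
  even : ∀ x, f (-x) = f x
  nonneg : ∀ x ∈ Icc (-1 : ℝ) 1, 0 ≤ f x
  deriv_le : ∀ a b, 0 ≤ a → a ≤ b → a + b ≤ 1 → deriv f b ≤ deriv f a

theorem IsMidConcave.deriv_neg {f : ℝ → ℝ} (hf : IsMidConcave f) (x : ℝ) :
    deriv f (-x) = -deriv f x := by
  have h := deriv_comp_neg f x
  rw [funext hf.even] at h
  linarith

theorem IsMidConcave.deriv_zero {f : ℝ → ℝ} (hf : IsMidConcave f) : deriv f 0 = 0 := by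
  have h := hf.deriv_neg 0
  rw [neg_zero] at h
  linarith

theorem IsMidConcave.deriv_integral_sub_mul {f : ℝ → ℝ} (hf : IsMidConcave f)
    (hpc : ContDiff ℝ 1 p) (x : ℝ) :
    deriv (fun x => ∫ y in (-1 : ℝ)..1, p (x - y) * f y) x =
      (∫ y in (0 : ℝ)..1, (p (x - y) - p (x + y)) * deriv f y) - f 1 * (p (x - 1) - p (x + 1)) := by
  have hfc : Continuous f := hf.contDiff.continuous
  have hf' : Continuous (deriv f) := hf.contDiff.continuous_deriv (by norm_num)
  have hp' : Continuous (deriv p) := hpc.continuous_deriv le_rfl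
  have hp0 : Continuous p := hpc.continuous
  have hii : ∀ {u : ℝ → ℝ} {a b : ℝ}, Continuous u → IntervalIntegrable u volume a b :=
    fun h => h.intervalIntegrable _ _
  have hpd : ∀ x, HasDerivAt p (deriv p x) x := fun x =>
    (hpc.differentiable one_ne_zero x).hasDerivAt
  rw [(hasDerivAt_integral_sub_mul hpd hp' hfc _ _ x).deriv]
  have parts := intervalIntegral.integral_deriv_mul_eq_sub (a := -1) (b := 1)
    (u := fun y => p (x - y)) (u' := fun y => -deriv p (x - y)) (v := f) (v' := deriv f)
    (fun y _ => (hpd (x - y)).comp_const_sub x y)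
    (fun y _ => (hf.contDiff.differentiable (by norm_num) y).hasDerivAt)
    (hii (by fun_prop)) (hii hf')
  rw [intervalIntegral.integral_add (hii (by fun_prop)) (hii (by fun_prop))] at parts
  simp only [neg_mul, intervalIntegral.integral_neg, sub_neg_eq_add, hf.even] at parts
  have split : ∫ y in (-1 : ℝ)..1, p (x - y) * deriv f y =
      ∫ y in (0 : ℝ)..1, (p (x - y) - p (x + y)) * deriv f y := by
    rw [← intervalIntegral.integral_add_adjacent_intervals (b := 0) (hii (by fun_prop))
      (hii (by fun_prop))]
    have h := intervalIntegral.integral_comp_neg (a := 0) (b := 1)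
      (fun y => p (x - y) * deriv f y)
    simp only [sub_neg_eq_add, hf.deriv_neg, neg_zero] at h
    rw [← h, ← intervalIntegral.integral_add (hii (by fun_prop)) (hii (by fun_prop))]
    congr 1 with y
    ring
  rw [← split]
  linarith

theorem IsMidConcave.integral_sub_mul {f : ℝ → ℝ} (hf : IsMidConcave f) (hpc : ContDiff ℝ 2 p)
    (hp : ∀ u v, |u| ≤ |v| → p v ≤ p u) (hp0 : ∀ u, 0 ≤ p u) :
    IsMidConcave (fun x => ∫ y in (-1 : ℝ)..1, p (x - y) * f y) where
  contDiff := contDiff_integral_sub_mul 2 hpc hf.contDiff.continuous _ _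
  even x := by
    have h := intervalIntegral.integral_comp_neg (a := -1) (b := 1) (fun y => p (x - y) * f y)
    rw [neg_neg] at h
    rw [← h]
    congr 1 with y
    have he : |-x - y| = |x - -y| := by rw [← abs_neg]; ring_nf
    rw [hf.even, le_antisymm (hp _ _ he.le) (hp _ _ he.ge)]
  nonneg x _ := intervalIntegral.integral_nonneg (by norm_num) fun y hy =>
    mul_nonneg (hp0 _) (hf.nonneg y hy)
  deriv_le a b ha hab hab1 := by
    have hpc' : Continuous p := hpc.continuous
    have hf' : Continuous (deriv f) := hf.contDiff.continuous_deriv (by norm_num)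
    have hii : ∀ {u : ℝ → ℝ} {a b : ℝ}, Continuous u → IntervalIntegrable u volume a b :=
      fun h => h.intervalIntegrable _ _
    rw [hf.deriv_integral_sub_mul (hpc.of_le (by norm_num)),
      hf.deriv_integral_sub_mul (hpc.of_le (by norm_num))]
    set l : ℝ → ℝ := fun y => (p (b - y) - p (b + y)) - (p (a - y) - p (a + y)) with hl
    have hlc : Continuous l := by fun_prop
    have sum_le : ∀ y, 0 ≤ y → p (b + y) ≤ p (a + y) := fun y hy => hp _ _ <| by
      rw [abs_of_nonneg (by linarith), abs_of_nonneg (by linarith)]; linarith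
    have hright : ∀ y ∈ Icc (1 / 2 : ℝ) 1, 0 ≤ l y := fun y hy => by
      have h1 := sum_le y (by linarith [hy.1])
      have h2 : p (a - y) ≤ p (b - y) := hp _ _ <| by
        rw [abs_of_nonpos (by linarith [hy.1] : a - y ≤ 0), abs_le]
        constructor <;> linarith [hy.1]
      simp only [hl]
      linarith
    have hcentred : ∀ c ∈ Icc (0 : ℝ) (1 / 2), 0 ≤ ∫ y in c..(1 - c), l y := fun c hc => by
      have h1 := integral_centred_le_of_radial_antitone hpc' hp hab hab1 hc.2
      have h2 : ∫ y in c..(1 - c), p (b + y) ≤ ∫ y in c..(1 - c), p (a + y) :=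
        intervalIntegral.integral_mono_on (by linarith [hc.2]) (hii (by fun_prop))
          (hii (by fun_prop)) fun y hy => sum_le y (hc.1.trans hy.1)
      simp only [hl]
      rw [intervalIntegral.integral_sub (hii (by fun_prop)) (hii (by fun_prop)),
        intervalIntegral.integral_sub (hii (by fun_prop)) (hii (by fun_prop)),
        intervalIntegral.integral_sub (hii (by fun_prop)) (hii (by fun_prop))]
      linarith
    have hg : ContDiff ℝ 1 (fun y => -deriv f y) :=
      ((contDiff_succ_iff_deriv (n := 1)).1 hf.contDiff).2.2.neg
    have key := integral_mul_nonneg_of_centred hg (by simp [hf.deriv_zero])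
      (fun x hx y hy hxy => neg_le_neg (hf.deriv_le x y hx.1 hxy (by linarith [hx.2, hy.2])))
      (fun y hy => neg_le_neg (hf.deriv_le y (1 - y) hy.1 (by linarith [hy.2]) (by linarith)))
      hlc hright hcentred
    have h1 := mul_nonneg (hf.nonneg 1 (by norm_num)) (hright 1 (by norm_num))
    have h2 : ∫ y in (0 : ℝ)..1, -deriv f y * l y =
        (∫ y in (0 : ℝ)..1, (p (a - y) - p (a + y)) * deriv f y) -
          ∫ y in (0 : ℝ)..1, (p (b - y) - p (b + y)) * deriv f y := by
      rw [← intervalIntegral.integral_sub (hii (by fun_prop)) (hii (by fun_prop))]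
      congr 1 with y
      simp only [hl]
      ring
    rw [h2] at key
    simp only [hl] at h1
    linarith

end Kernel

theorem IsMidConcave.concaveOn {f : ℝ → ℝ} (hf : IsMidConcave f) :
    ConcaveOn ℝ (Ioo (-(1 / 2) : ℝ) (1 / 2)) f := by
  have hd : Differentiable ℝ f := hf.contDiff.differentiable (by norm_num)
  have h0 : deriv f 0 = 0 := hf.deriv_zero
  refine AntitoneOn.concaveOn_of_deriv (convex_Ioo _ _) hd.continuous.continuousOn
    hd.differentiableOn ?_
  rw [interior_Ioo]
  intro x hx y hy hxy
  rcases le_total 0 x with h | h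
  · exact hf.deriv_le x y h hxy (by linarith [hx.2, hy.2])
  have hx' : 0 ≤ deriv f x := by
    have := hf.deriv_le 0 (-x) le_rfl (by linarith) (by linarith [hx.1])
    rw [hf.deriv_neg] at this
    linarith
  rcases le_total 0 y with h' | h'
  · have := hf.deriv_le 0 y le_rfl h' (by linarith [hy.2])
    linarith
  · have := hf.deriv_le (-y) (-x) (by linarith) (by linarith) (by linarith [hx.1, hy.1])
    rw [hf.deriv_neg, hf.deriv_neg] at this
    linarith

theorem isMidConcave_const {c : ℝ} (hc : 0 ≤ c) : IsMidConcave fun _ => c where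
  contDiff := contDiff_const
  even _ := rfl
  nonneg _ _ := hc
  deriv_le := by simp

theorem contDiff_gaussDensity (t : ℝ) : ContDiff ℝ 2 (gaussDensity t) := by
  unfold gaussDensity
  fun_prop

theorem gaussDensity_nonneg (t x : ℝ) : 0 ≤ gaussDensity t x := by
  unfold gaussDensity
  positivity

theorem gaussDensity_le_of_abs_le {t : ℝ} (ht : 0 < t) {u v : ℝ} (h : |u| ≤ |v|) :
    gaussDensity t v ≤ gaussDensity t u := by
  have := sq_le_sq.2 h
  unfold gaussDensity
  gcongr

theorem Phi_succ {n : ℕ} (t : Fin (n + 1) → ℝ) (x : ℝ) :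
    Phi (n + 1) t x =
      ∫ y in (-1 : ℝ)..1, gaussDensity (t 0) (x - y) * Phi n (fun i => t i.succ) y := by
  have hgc : ∀ t, Continuous (gaussDensity t) := fun t => (contDiff_gaussDensity t).continuous
  set e : ℝ × (Fin n → ℝ) ≃ᵐ (Fin (n + 1) → ℝ) :=
    (MeasurableEquiv.piFinSuccAbove (fun _ => ℝ) 0).symm
  have hem : MeasurePreserving e :=
    (volume_preserving_piFinSuccAbove (fun _ : Fin (n + 1) => ℝ) 0).symm _
  have he : ∀ z, e z = Fin.cons z.1 z.2 := fun z => by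
    simp [e, MeasurableEquiv.piFinSuccAbove_symm_apply, Fin.insertNthEquiv]
  have hpre : (e ⁻¹' Icc (fun _ => -1) fun _ => 1) =
      Icc (-1 : ℝ) 1 ×ˢ Icc (fun _ : Fin n => (-1 : ℝ)) fun _ => 1 := by
    ext z
    simp [he, Pi.le_def, Prod.le_def, Fin.forall_fin_succ]
  have hint : ∀ z : ℝ × (Fin n → ℝ), ∏ i : Fin (n + 1), gaussDensity (t i)
      ((Fin.cons x (e z) : Fin (n + 2) → ℝ) i.castSucc - (Fin.cons x (e z) : Fin (n + 2) → ℝ) i.succ)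
      = gaussDensity (t 0) (x - z.1) * ∏ i : Fin n, gaussDensity (t i.succ)
      ((Fin.cons z.1 z.2 : Fin (n + 1) → ℝ) i.castSucc -
        (Fin.cons z.1 z.2 : Fin (n + 1) → ℝ) i.succ) := fun z => by
    rw [Fin.prod_univ_succ, he]
    simp
  unfold Phi
  rw [← hem.map_eq, setIntegral_map_equiv, hpre]
  simp only [hint]
  rw [Measure.volume_eq_prod, setIntegral_prod, intervalIntegral.integral_of_le (by norm_num),
    ← integral_Icc_eq_integral_Ioc]
  · simp only [integral_const_mul]
  · rw [← Measure.volume_eq_prod]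
    refine ContinuousOn.integrableOn_compact (isCompact_Icc.prod isCompact_Icc)
      (Continuous.continuousOn ?_)
    refine ((hgc _).comp (by fun_prop)).mul (continuous_finsetProd _ fun i _ => (hgc _).comp ?_)
    have hcons : Continuous fun z : ℝ × (Fin n → ℝ) => (Fin.cons z.1 z.2 : Fin (n + 1) → ℝ) :=
      Continuous.finCons (A := fun _ => ℝ) continuous_fst continuous_snd
    exact ((continuous_apply _).comp hcons).sub ((continuous_apply _).comp hcons)

theorem isMidConcave_Phi (n : ℕ) (t : Fin n → ℝ) (ht : ∀ i, 0 < t i) : IsMidConcave (Phi n t) := by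
  induction n with
  | zero =>
    have : Phi 0 t = fun _ => Phi 0 t 0 := by
      ext x
      simp [Phi]
    rw [this]
    exact isMidConcave_const (by simp [Phi])
  | succ n ih =>
    rw [funext (Phi_succ t)]
    exact (ih _ fun i => ht i.succ).integral_sub_mul (contDiff_gaussDensity _)
      (fun _ _ => gaussDensity_le_of_abs_le (ht 0)) (gaussDensity_nonneg _)

/-- `Φ_n` is concave on `(-1/2, 1/2)`. -/
theorem phi_concave_on_middle (n : ℕ) (hn : 0 < n) (t : Fin n → ℝ)
    (ht : ∀ i, 0 < t i) :
    ConcaveOn ℝ (Set.Ioo (-(1 / 2) : ℝ) (1 / 2)) (Phi n t) :=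
  (isMidConcave_Phi n t ht).concaveOn
end

section
/- Let 0 < α ≤ 2, let a > 0, and let 0 < t_1 < t_2 < ⋯ < t_n. Define F : ℝ → ℝ by F(x) = ∫_{-a}^{a} ⋯ ∫_{-a}^{a} ∏_{i=1}^{n} q^α_{t_i - t_{i-1}}(x_{i-1} - x_i) dx_1 ⋯ dx_n, where x_0 = x and t_0 = 0. Then F is concave on the interval (-a/2, a/2); moreover F is nondecreasing on (-a, 0) and nonincreasing on (0, a). -/
open MeasureTheory Real

/-- The density of the one-dimensional symmetric `α`-stable process at time `t`,
defined by Fourier inversion: `q^α_t(y) = (2π)⁻¹ ∫_ℝ cos(ξy) e^{-t|ξ|^α} dξ`. -/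
noncomputable def stableDensity (α t y : ℝ) : ℝ :=
  (2 * Real.pi)⁻¹ * ∫ ξ : ℝ, Real.cos (ξ * y) * Real.exp (-t * |ξ| ^ α)

/-- `F(x) = ∫_{-a}^{a} ⋯ ∫_{-a}^{a} ∏_{i=1}^{n} q^α_{t_i - t_{i-1}}(x_{i-1} - x_i) dx_1 ⋯ dx_n`,
with `x_0 = x` and `t_0 = 0`.  This is the finite-dimensional distribution
`P_x{X^α_{t_1} ∈ (-a,a), ..., X^α_{t_n} ∈ (-a,a)}` of the symmetric `α`-stable process. -/
noncomputable def stableFDD (n : ℕ) (α a : ℝ) (t : Fin n → ℝ) (x : ℝ) : ℝ :=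
  ∫ y in Set.Icc (fun _ : Fin n => -a) (fun _ : Fin n => a),
    ∏ i : Fin n,
      stableDensity α
        ((Fin.cons 0 t : Fin (n + 1) → ℝ) i.succ - (Fin.cons 0 t : Fin (n + 1) → ℝ) i.castSucc)
        ((Fin.cons x y : Fin (n + 1) → ℝ) i.castSucc - (Fin.cons x y : Fin (n + 1) → ℝ) i.succ)

/-- A nonnegative even function on the line that is nonincreasing on `[0, ∞)`. -/
structure SymmUnimodal (q : ℝ → ℝ) : Prop where
  nonneg : ∀ x, 0 ≤ q x
  even : ∀ x, q (-x) = q x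
  antitoneOn : AntitoneOn q (Set.Ici 0)

namespace SymmUnimodal

theorem apply_abs {q : ℝ → ℝ} (hq : SymmUnimodal q) (x : ℝ) : q |x| = q x := by
  rcases abs_choice x with h | h <;> simp [h, hq.even]

theorem le_of_abs_le {q : ℝ → ℝ} (hq : SymmUnimodal q) {x y : ℝ} (h : |x| ≤ |y|) : q y ≤ q x := by
  rw [← hq.apply_abs x, ← hq.apply_abs y]
  exact hq.antitoneOn (abs_nonneg x) (abs_nonneg y) h

theorem abs_le_apply_zero {q : ℝ → ℝ} (hq : SymmUnimodal q) (x : ℝ) : |q x| ≤ q 0 := by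
  rw [abs_of_nonneg (hq.nonneg x)]
  exact hq.le_of_abs_le (by simp)

theorem integrable_mul {q u : ℝ → ℝ} (hq : SymmUnimodal q) (hqc : Continuous q)
    (hu : Integrable u) {l : ℝ → ℝ} (hl : Continuous l) : Integrable fun w => q (l w) * u w :=
  hu.bdd_mul (c := q 0) (hqc.comp hl).aestronglyMeasurable
    (Filter.Eventually.of_forall fun _ => hq.abs_le_apply_zero _)

/-- The convolution of two symmetric unimodal functions is symmetric unimodal. -/
theorem convolution {q u : ℝ → ℝ} (hq : SymmUnimodal q) (hqc : Continuous q)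
    (hu : SymmUnimodal u) (hui : Integrable u) :
    SymmUnimodal fun x => ∫ w, q (x - w) * u w where
  nonneg x := integral_nonneg fun w => mul_nonneg (hq.nonneg _) (hu.nonneg _)
  even x := by
    rw [← integral_neg_eq_self]
    refine integral_congr_ae (Filter.Eventually.of_forall fun w => ?_)
    simp only
    rw [hu.even, ← hq.even (x - w)]
    ring_nf
  antitoneOn := by
    intro h hh k _ hk
    obtain ⟨m, d, rfl, rfl⟩ : ∃ m d : ℝ, h = m - d ∧ k = m + d :=
      ⟨(h + k) / 2, (k - h) / 2, by ring, by ring⟩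
    have hd : 0 ≤ d := by linarith
    have hm : 0 ≤ m := by have : 0 ≤ m - d := hh; linarith
    have hup : Integrable fun v => u (m + v) := hui.comp_add_left m
    have hum : Integrable fun v => u (m - v) := hui.comp_sub_left m
    have cp : Continuous fun v : ℝ => v + d := by fun_prop
    have cm : Continuous fun v : ℝ => v - d := by fun_prop
    have e1 : ∫ w, q (m - d - w) * u w = ∫ v, q (v + d) * u (m + v) := by
      rw [← integral_add_left_eq_self _ m]
      refine integral_congr_ae (Filter.Eventually.of_forall fun v => ?_)
      simp only
      rw [← hq.even (v + d)]
      ring_nf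
    have e2 : ∫ w, q (m - d - w) * u w = ∫ v, q (v - d) * u (m - v) := by
      rw [← integral_sub_left_eq_self _ volume m]
      refine integral_congr_ae (Filter.Eventually.of_forall fun v => ?_)
      simp only
      ring_nf
    have e3 : ∫ w, q (m + d - w) * u w = ∫ v, q (v - d) * u (m + v) := by
      rw [← integral_add_left_eq_self _ m]
      refine integral_congr_ae (Filter.Eventually.of_forall fun v => ?_)
      simp only
      rw [← hq.even (v - d)]
      ring_nf
    have e4 : ∫ w, q (m + d - w) * u w = ∫ v, q (v + d) * u (m - v) := by
      rw [← integral_sub_left_eq_self _ volume m]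
      refine integral_congr_ae (Filter.Eventually.of_forall fun v => ?_)
      simp only
      ring_nf
    have key : 0 ≤ ∫ v, (q (v + d) * u (m + v) + q (v - d) * u (m - v)
        - (q (v - d) * u (m + v) + q (v + d) * u (m - v))) := by
      refine integral_nonneg fun v => ?_
      have : q (v + d) * u (m + v) + q (v - d) * u (m - v)
        - (q (v - d) * u (m + v) + q (v + d) * u (m - v))
        = (q (v + d) - q (v - d)) * (u (m + v) - u (m - v)) := by ring
      simp only [Pi.zero_apply]
      rw [this]
      rcases le_total 0 v with hv | hv
      · refine mul_nonneg_of_nonpos_of_nonpos (sub_nonpos.2 (hq.le_of_abs_le ?_))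
          (sub_nonpos.2 (hu.le_of_abs_le ?_)) <;> rw [← sq_le_sq] <;> nlinarith
      · refine mul_nonneg (sub_nonneg.2 (hq.le_of_abs_le ?_))
          (sub_nonneg.2 (hu.le_of_abs_le ?_)) <;> rw [← sq_le_sq] <;> nlinarith
    have i1 := hq.integrable_mul hqc hup cp
    have i2 := hq.integrable_mul hqc hum cm
    have i3 := hq.integrable_mul hqc hup cm
    have i4 := hq.integrable_mul hqc hum cp
    have split := integral_sub (i1.add i2) (i3.add i4)
    simp only [Pi.add_apply] at split
    rw [split, integral_add i1 i2, integral_add i3 i4, ← e1, ← e2, ← e3, ← e4] at key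
    simp only
    linarith

end SymmUnimodal

/-- An even nonnegative function whose symmetrizations about the points of `[-a/2, a/2]` are all
symmetric unimodal. -/
structure MidUnimodal (a : ℝ) (f : ℝ → ℝ) : Prop where
  nonneg : ∀ x, 0 ≤ f x
  even : ∀ x, f (-x) = f x
  symmUnimodal : ∀ c, 0 ≤ c → c ≤ a / 2 → SymmUnimodal fun w => f (c + w) + f (c - w)

namespace MidUnimodal

theorem antitoneOn {a : ℝ} (ha : 0 < a) {f : ℝ → ℝ} (hf : MidUnimodal a f) :
    AntitoneOn f (Set.Ici 0) := by
  intro x hx y hy hxy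
  have := (hf.symmUnimodal 0 le_rfl (by positivity)).antitoneOn hx hy hxy
  simp only [zero_add, zero_sub, hf.even] at this
  linarith

theorem one (a : ℝ) : MidUnimodal a fun _ => 1 where
  nonneg _ := zero_le_one
  even _ := rfl
  symmUnimodal _ _ _ := ⟨fun _ => by norm_num, fun _ => rfl, fun _ _ _ _ _ => le_rfl⟩

theorem indicator {a : ℝ} (ha : 0 < a) {f : ℝ → ℝ} (hf : MidUnimodal a f) :
    MidUnimodal a ((Set.Icc (-a) a).indicator f) where
  nonneg x := Set.indicator_nonneg (fun y _ => hf.nonneg y) x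
  even x := by
    by_cases hx : x ∈ Set.Icc (-a) a
    · have : -x ∈ Set.Icc (-a) a := ⟨by linarith [hx.2], by linarith [hx.1]⟩
      simp [hx, this, hf.even]
    · have : -x ∉ Set.Icc (-a) a := fun h => hx ⟨by linarith [h.2], by linarith [h.1]⟩
      simp [hx, this]
  symmUnimodal c hc0 hc := by
    refine ⟨fun w => add_nonneg (Set.indicator_nonneg (fun y _ => hf.nonneg y) _)
      (Set.indicator_nonneg (fun y _ => hf.nonneg y) _), fun w => by
        rw [sub_neg_eq_add, ← sub_eq_add_neg, add_comm], ?_⟩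
    intro w hw w' hw' hww
    have hw0 : 0 ≤ w := hw
    have hmid := (hf.symmUnimodal c hc0 hc).antitoneOn hw hw' hww
    have hdec : 0 ≤ w - c → f (c - w') ≤ f (c - w) := fun h => by
      rw [← hf.even (c - w'), ← hf.even (c - w)]
      exact hf.antitoneOn ha (by simpa using h) (by simp; linarith) (by linarith)
    have n1 := hf.nonneg (c + w)
    have n2 := hf.nonneg (c - w)
    have n3 := hf.nonneg (c + w')
    have n4 := hf.nonneg (c - w')
    have hmid' : f (c + w') + f (c - w') ≤ f (c + w) + f (c - w) := hmid
    simp only [Set.indicator_apply, Set.mem_Icc]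
    split_ifs <;> grind

theorem convolution {a : ℝ} {q f : ℝ → ℝ} (hq : SymmUnimodal q) (hqc : Continuous q)
    (hf : MidUnimodal a f) (hfi : Integrable f) :
    MidUnimodal a fun x => ∫ w, q (x - w) * f w where
  nonneg x := integral_nonneg fun w => mul_nonneg (hq.nonneg _) (hf.nonneg _)
  even x := by
    rw [← integral_neg_eq_self]
    refine integral_congr_ae (Filter.Eventually.of_forall fun w => ?_)
    simp only
    rw [hf.even, ← hq.even (x - w)]
    ring_nf
  symmUnimodal c hc0 hc := by
    have ip : Integrable fun w => f (c + w) := hfi.comp_add_left c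
    have im : Integrable fun w => f (c - w) := hfi.comp_sub_left c
    convert hq.convolution hqc (hf.symmUnimodal c hc0 hc) (ip.add im) using 2 with h
    have hl : Continuous fun w : ℝ => h - w := by fun_prop
    simp only [mul_add]
    rw [integral_add (hq.integrable_mul hqc ip hl) (hq.integrable_mul hqc im hl)]
    congr 1
    · rw [← integral_add_left_eq_self _ c]
      refine integral_congr_ae (Filter.Eventually.of_forall fun v => ?_)
      simp only
      ring_nf
    · rw [← integral_sub_left_eq_self _ volume c]
      refine integral_congr_ae (Filter.Eventually.of_forall fun v => ?_)
      simp only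
      rw [← hq.even (h - v)]
      ring_nf

end MidUnimodal

/-- A continuous midpoint concave function on an open interval is concave. -/
theorem concaveOn_Ioo_of_midpoint {l r : ℝ} {f : ℝ → ℝ} (hf : Continuous f)
    (hmid : ∀ x ∈ Set.Ioo l r, ∀ w, x - w ∈ Set.Ioo l r → x + w ∈ Set.Ioo l r →
      f (x + w) + f (x - w) ≤ 2 * f x) : ConcaveOn ℝ (Set.Ioo l r) f := by
  refine LinearOrder.concaveOn_of_lt (convex_Ioo l r) fun x hx y hy hxy s t hs ht hst => ?_
  by_contra! hlt
  simp only [smul_eq_mul] at hlt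
  obtain ⟨p, b, hpx, hpy⟩ : ∃ p b : ℝ, p * x + b = f x ∧ p * y + b = f y := by
    have : y - x ≠ 0 := by linarith
    refine ⟨(f y - f x) / (y - x), f x - (f y - f x) / (y - x) * x, by ring, ?_⟩
    field_simp
    ring
  set h : ℝ → ℝ := fun z => f z - (p * z + b) with hh
  have hc : Continuous h := by fun_prop
  obtain ⟨m, hm, hmin⟩ := isCompact_Icc.exists_isMinOn (Set.nonempty_Icc.2 hxy.le) hc.continuousOn
  have hK : IsCompact (Set.Icc x y ∩ {z | h z ≤ h m}) :=
    isCompact_Icc.inter_right (isClosed_le hc continuous_const)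
  obtain ⟨m', ⟨hm'I, hm'⟩, hleast⟩ := hK.exists_isLeast ⟨m, hm, le_refl (h m)⟩
  have hz : s * x + t * y ∈ Set.Icc x y :=
    (convex_Icc x y) (Set.left_mem_Icc.2 hxy.le) (Set.right_mem_Icc.2 hxy.le) hs.le ht.le hst
  have hneg : h m < 0 := by
    refine lt_of_le_of_lt (hmin hz) ?_
    have : p * (s * x + t * y) + b = s * f x + t * f y := by
      rw [← hpx, ← hpy]; linear_combination -b * hst
    simp only [hh]
    linarith
  have hx0 : h x = 0 := by simp [hh, hpx]
  have hy0 : h y = 0 := by simp [hh, hpy]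
  replace hm' : h m' ≤ h m := hm'
  have hxm : x < m' := lt_of_le_of_ne hm'I.1 fun e => by rw [← e, hx0] at hm'; linarith
  have hmy : m' < y := lt_of_le_of_ne hm'I.2 fun e => by rw [e, hy0] at hm'; linarith
  obtain ⟨δ, hδ, hδx, hδy⟩ : ∃ δ, 0 < δ ∧ x ≤ m' - δ ∧ m' + δ ≤ y :=
    ⟨min (m' - x) (y - m'), lt_min (by linarith) (by linarith),
      by linarith [min_le_left (m' - x) (y - m')], by linarith [min_le_right (m' - x) (y - m')]⟩
  have hleft : h m < h (m' - δ) := by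
    by_contra! hle
    have := hleast ⟨⟨hδx, by linarith⟩, hle⟩
    linarith
  have hright : h m ≤ h (m' + δ) := hmin ⟨by linarith, hδy⟩
  have := hmid m' ⟨by linarith [hx.1], by linarith [hy.2]⟩ δ
    ⟨by linarith [hx.1], by linarith [hy.2]⟩ ⟨by linarith [hx.1], by linarith [hy.2]⟩
  simp only [hh] at hleft hright hm'
  linarith

/-- The total mass seen from `x` of the paths that start at `x`, jump according to the kernels
`q 0, q 1, …` and are found in `[-a, a]` after each jump. -/
noncomputable def boxPathIntegral (a : ℝ) {n : ℕ} (q : Fin n → ℝ → ℝ) (x : ℝ) : ℝ :=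
  ∫ y in Set.Icc (fun _ : Fin n => -a) (fun _ : Fin n => a),
    ∏ i : Fin n,
      q i ((Fin.cons x y : Fin (n + 1) → ℝ) i.castSucc - (Fin.cons x y : Fin (n + 1) → ℝ) i.succ)

theorem boxPathIntegral_zero (a : ℝ) (q : Fin 0 → ℝ → ℝ) (x : ℝ) : boxPathIntegral a q x = 1 := by
  have : Set.Icc (fun _ : Fin 0 => -a) (fun _ : Fin 0 => a) = Set.univ :=
    Set.eq_univ_of_forall fun y => ⟨fun i => i.elim0, fun i => i.elim0⟩
  simp [boxPathIntegral, this, volume_pi, Measure.real]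

theorem boxPathIntegral_succ (a : ℝ) {n : ℕ} (q : Fin (n + 1) → ℝ → ℝ)
    (hq : ∀ i, Continuous (q i)) (x : ℝ) :
    boxPathIntegral a q x =
      ∫ z in Set.Icc (-a) a, q 0 (x - z) * boxPathIntegral a (fun i => q i.succ) z := by
  have hpre : (MeasurableEquiv.piFinSuccAbove (fun _ : Fin (n + 1) => ℝ) 0).symm ⁻¹'
      Set.Icc (fun _ => -a) (fun _ => a) =
      Set.Icc (-a) a ×ˢ Set.Icc (fun _ : Fin n => -a) (fun _ : Fin n => a) := by
    ext p
    simp only [Set.mem_preimage, Set.mem_prod, Set.mem_Icc, Pi.le_def, Fin.forall_fin_succ,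
      MeasurableEquiv.piFinSuccAbove, Fin.insertNthEquiv]
    simp
    tauto
  rw [boxPathIntegral, ← ((volume_preserving_piFinSuccAbove
    (fun _ : Fin (n + 1) => ℝ) 0).symm).setIntegral_preimage_emb
    (MeasurableEquiv.measurableEmbedding _), hpre]
  have hval : ∀ p : ℝ × (Fin n → ℝ), (∏ i : Fin (n + 1), q i
      ((Fin.cons x ((MeasurableEquiv.piFinSuccAbove (fun _ : Fin (n + 1) => ℝ) 0).symm p) :
        Fin (n + 2) → ℝ) i.castSucc -
      (Fin.cons x ((MeasurableEquiv.piFinSuccAbove (fun _ : Fin (n + 1) => ℝ) 0).symm p) :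
        Fin (n + 2) → ℝ) i.succ)) = q 0 (x - p.1) * ∏ i : Fin n, q i.succ
        ((Fin.cons p.1 p.2 : Fin (n + 1) → ℝ) i.castSucc -
          (Fin.cons p.1 p.2 : Fin (n + 1) → ℝ) i.succ) := by
    intro p
    rw [Fin.prod_univ_succ]
    simp [MeasurableEquiv.piFinSuccAbove, Fin.insertNthEquiv]
  simp only [hval]
  rw [Measure.volume_eq_prod, setIntegral_prod]
  · simp only [integral_const_mul, boxPathIntegral]
  · refine ContinuousOn.integrableOn_compact (isCompact_Icc.prod isCompact_Icc)
      (Continuous.continuousOn ?_)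
    refine ((hq 0).comp (by fun_prop)).mul (continuous_finsetProd _ fun i _ => (hq i.succ).comp ?_)
    have hc : Continuous fun p : ℝ × (Fin n → ℝ) => (Fin.cons p.1 p.2 : Fin (n + 1) → ℝ) :=
      continuous_pi (Fin.cases continuous_fst fun i => (continuous_apply i).comp continuous_snd)
    exact ((continuous_apply _).comp hc).sub ((continuous_apply _).comp hc)

theorem continuous_and_midUnimodal_boxPathIntegral {a : ℝ} (ha : 0 < a) :
    ∀ {n : ℕ} (q : Fin n → ℝ → ℝ), (∀ i, Continuous (q i)) → (∀ i, SymmUnimodal (q i)) →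
      Continuous (boxPathIntegral a q) ∧ MidUnimodal a (boxPathIntegral a q)
  | 0, q, _, _ => by
    rw [funext (boxPathIntegral_zero a q)]
    exact ⟨continuous_const, MidUnimodal.one a⟩
  | n + 1, q, hqc, hq => by
    obtain ⟨hc, hmid⟩ := continuous_and_midUnimodal_boxPathIntegral ha (fun i => q i.succ)
      (fun i => hqc i.succ) (fun i => hq i.succ)
    rw [funext (boxPathIntegral_succ a q hqc)]
    refine ⟨continuous_parametric_integral_of_continuous (f := fun x z => q 0 (x - z) *
      boxPathIntegral a (fun i => q i.succ) z) ?_ isCompact_Icc, ?_⟩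
    · exact ((hqc 0).comp (continuous_fst.sub continuous_snd)).mul (hc.comp continuous_snd)
    · convert MidUnimodal.convolution (hq 0) (hqc 0) (hmid.indicator ha)
        ((hc.continuousOn.integrableOn_compact isCompact_Icc).integrable_indicator
          measurableSet_Icc) using 2 with x
      rw [← integral_indicator measurableSet_Icc]
      congr 1 with z
      by_cases hz : z ∈ Set.Icc (-a) a <;> simp [hz]

namespace SymmUnimodal

theorem add {p q : ℝ → ℝ} (hp : SymmUnimodal p) (hq : SymmUnimodal q) :
    SymmUnimodal fun x => p x + q x where
  nonneg x := add_nonneg (hp.nonneg x) (hq.nonneg x)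
  even x := by simp only [hp.even, hq.even]
  antitoneOn := hp.antitoneOn.add hq.antitoneOn

theorem const_mul {q : ℝ → ℝ} (hq : SymmUnimodal q) {c : ℝ} (hc : 0 ≤ c) :
    SymmUnimodal fun x => c * q x where
  nonneg x := mul_nonneg hc (hq.nonneg x)
  even x := by simp only [hq.even]
  antitoneOn _ hx _ hy hxy := mul_le_mul_of_nonneg_left (hq.antitoneOn hx hy hxy) hc

theorem of_tendsto {p : ℕ → ℝ → ℝ} {q : ℝ → ℝ} (hp : ∀ n, SymmUnimodal (p n))
    (h : ∀ x, Filter.Tendsto (fun n => p n x) Filter.atTop (nhds (q x))) : SymmUnimodal q where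
  nonneg x := ge_of_tendsto' (h x) fun n => (hp n).nonneg x
  even x := tendsto_nhds_unique (h (-x)) (by simpa only [(hp _).even] using h x)
  antitoneOn x hx y hy hxy := le_of_tendsto_of_tendsto' (h y) (h x) fun n =>
    (hp n).antitoneOn hx hy hxy

end SymmUnimodal

/-- The smallest class of functions on `(0, ∞)` that contains the exponentials `l ↦ exp (-s * l)`
with `0 ≤ s` and is closed under sums, nonnegative multiples and bounded pointwise limits. Values
at nonpositive arguments are irrelevant. -/
inductive LaplaceCone : (ℝ → ℝ) → Prop
  | exp (s : ℝ) : 0 ≤ s → LaplaceCone fun l => Real.exp (-s * l)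
  | add {φ ψ : ℝ → ℝ} : LaplaceCone φ → LaplaceCone ψ → LaplaceCone fun l => φ l + ψ l
  | const_mul {φ : ℝ → ℝ} (c : ℝ) : 0 ≤ c → LaplaceCone φ → LaplaceCone fun l => c * φ l
  | lim {φ : ℕ → ℝ → ℝ} {ψ : ℝ → ℝ} (C : ℝ) : (∀ n, LaplaceCone (φ n)) →
      (∀ n, ∀ l > 0, |φ n l| ≤ C) →
      (∀ l > 0, Filter.Tendsto (fun n => φ n l) Filter.atTop (nhds (ψ l))) → LaplaceCone ψ

namespace LaplaceCone

theorem nonneg {φ : ℝ → ℝ} (h : LaplaceCone φ) : ∀ l > 0, 0 ≤ φ l := by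
  induction h with
  | exp s hs => exact fun l _ => (Real.exp_pos _).le
  | add _ _ h₁ h₂ => exact fun l hl => add_nonneg (h₁ l hl) (h₂ l hl)
  | const_mul c hc _ h => exact fun l hl => mul_nonneg hc (h l hl)
  | lim C _ _ ht h => exact fun l hl => ge_of_tendsto' (ht l hl) fun n => h n l hl

theorem bounded {φ : ℝ → ℝ} (h : LaplaceCone φ) : ∃ C, ∀ l > 0, |φ l| ≤ C := by
  induction h with
  | exp s hs =>
    refine ⟨1, fun l hl => ?_⟩
    rw [abs_of_pos (Real.exp_pos _), Real.exp_le_one_iff]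
    nlinarith [mul_nonneg hs (le_of_lt hl)]
  | add _ _ h₁ h₂ =>
    obtain ⟨C₁, h₁⟩ := h₁
    obtain ⟨C₂, h₂⟩ := h₂
    exact ⟨C₁ + C₂, fun l hl => (abs_add_le _ _).trans (add_le_add (h₁ l hl) (h₂ l hl))⟩
  | const_mul c hc _ h =>
    obtain ⟨C, h⟩ := h
    refine ⟨c * C, fun l hl => ?_⟩
    rw [abs_mul, abs_of_nonneg hc]
    exact mul_le_mul_of_nonneg_left (h l hl) hc
  | lim C _ hb ht _ => exact ⟨C, fun l hl => le_of_tendsto' (ht l hl).abs fun n => hb n l hl⟩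

theorem mul {φ ψ : ℝ → ℝ} (hφ : LaplaceCone φ) (hψ : LaplaceCone ψ) :
    LaplaceCone fun l => φ l * ψ l := by
  induction hφ with
  | exp s hs =>
    induction hψ with
    | exp r hr =>
      convert LaplaceCone.exp (s + r) (add_nonneg hs hr) using 2 with l
      rw [← Real.exp_add]
      ring_nf
    | add _ _ h₁ h₂ => simpa only [mul_add] using h₁.add h₂
    | const_mul c hc _ h => simpa only [mul_left_comm] using h.const_mul c hc
    | lim C _ hb ht h =>
      refine LaplaceCone.lim C h (fun n l hl => ?_) fun l hl => (ht l hl).const_mul _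
      rw [abs_mul, abs_of_pos (Real.exp_pos _)]
      have h1 : Real.exp (-s * l) ≤ 1 := by
        rw [Real.exp_le_one_iff]
        nlinarith [mul_nonneg hs (le_of_lt hl)]
      exact (mul_le_of_le_one_left (abs_nonneg _) h1).trans (hb n l hl)
  | add _ _ h₁ h₂ => simpa only [add_mul] using h₁.add h₂
  | const_mul c hc _ h => simpa only [mul_assoc] using h.const_mul c hc
  | lim C _ hb ht h =>
    obtain ⟨D, hD⟩ := hψ.bounded
    refine LaplaceCone.lim (C * D) h (fun n l hl => ?_) fun l hl => (ht l hl).mul_const _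
    rw [abs_mul]
    exact mul_le_mul (hb n l hl) (hD l hl) (abs_nonneg _) ((abs_nonneg _).trans (hb n l hl))

theorem const {c : ℝ} (hc : 0 ≤ c) : LaplaceCone fun _ => c := by
  simpa using (LaplaceCone.exp 0 le_rfl).const_mul c hc

theorem pow {φ : ℝ → ℝ} (h : LaplaceCone φ) : ∀ n : ℕ, LaplaceCone fun l => φ l ^ n
  | 0 => by simpa using const zero_le_one
  | n + 1 => by simpa only [pow_succ] using (pow h n).mul h

theorem sum_range {φ : ℕ → ℝ → ℝ} (h : ∀ n, LaplaceCone (φ n)) :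
    ∀ n : ℕ, LaplaceCone fun l => ∑ k ∈ Finset.range n, φ k l
  | 0 => by simpa using const le_rfl
  | n + 1 => by simpa only [Finset.sum_range_succ] using (sum_range h n).add (h n)

/-- A bounded sum of a series of members of the cone is in the cone. -/
theorem of_hasSum {φ : ℕ → ℝ → ℝ} {ψ : ℝ → ℝ} (h : ∀ n, LaplaceCone (φ n)) (C : ℝ)
    (hs : ∀ l > 0, HasSum (fun n => φ n l) (ψ l)) (hb : ∀ l > 0, ψ l ≤ C) : LaplaceCone ψ := by
  refine LaplaceCone.lim C (sum_range h) (fun n l hl => ?_) fun l hl => (hs l hl).tendsto_sum_nat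
  rw [abs_of_nonneg (Finset.sum_nonneg fun k _ => (h k).nonneg l hl)]
  exact (sum_le_hasSum _ (fun k _ => (h k).nonneg l hl) (hs l hl)).trans (hb l hl)

theorem exp_comp {φ : ℝ → ℝ} (h : LaplaceCone φ) : LaplaceCone fun l => Real.exp (φ l) := by
  obtain ⟨C, hC⟩ := h.bounded
  refine of_hasSum (fun n => (h.pow n).const_mul (n.factorial : ℝ)⁻¹ (by positivity))
    (Real.exp C) (fun l hl => ?_) fun l hl => Real.exp_le_exp.2 ((le_abs_self _).trans (hC l hl))
  have := NormedSpace.expSeries_div_hasSum_exp (φ l)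
  rw [← Real.exp_eq_exp_ℝ] at this
  simpa only [div_eq_inv_mul] using this

end LaplaceCone

theorem multichoose_neg_succ_nonpos {β : ℝ} (h0 : 0 ≤ β) (h1 : β ≤ 1) (n : ℕ) :
    Ring.multichoose (-β) (n + 1) ≤ 0 := by
  have h := Ring.factorial_nsmul_multichoose_eq_ascPochhammer (-β) (n + 1)
  rw [Polynomial.ascPochhammer_smeval_eq_eval, nsmul_eq_mul] at h
  have hp : ∀ k : ℕ, (ascPochhammer ℝ (k + 1)).eval (-β) ≤ 0 := by
    intro k
    induction k with
    | zero => simpa using h0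
    | succ k ih =>
      rw [ascPochhammer_succ_eval]
      refine mul_nonpos_of_nonpos_of_nonneg ih ?_
      push_cast
      linarith [(Nat.cast_nonneg k : (0 : ℝ) ≤ k)]
  have hn := hp n
  rw [← h] at hn
  have hf : (0 : ℝ) < (n + 1).factorial := by positivity
  by_contra! hpos
  nlinarith [mul_pos hf hpos]

/-- The binomial series of `1 - (1 - x) ^ β` has nonnegative coefficients if `0 ≤ β ≤ 1`. -/
theorem hasSum_one_sub_one_sub_rpow (β : ℝ) {x : ℝ} (hx0 : 0 ≤ x) (hx1 : x < 1) :
    HasSum (fun n : ℕ => -Ring.multichoose (-β) (n + 1) * x ^ (n + 1)) (1 - (1 - x) ^ β) := by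
  have h := (one_div_one_sub_rpow_hasFPowerSeriesOnBall_zero (-β)).hasSum (y := x) (by
    simp only [Metric.mem_eball, edist_zero_right]
    rw [← ofReal_norm, Real.norm_of_nonneg hx0]
    simpa using hx1)
  simp only [FormalMultilinearSeries.ofScalars_apply_eq, zero_add, ← Ring.multichoose_eq,
    Real.rpow_neg (sub_nonneg.2 hx1.le), one_div, inv_inv, smul_eq_mul] at h
  rw [← hasSum_nat_add_iff' 1] at h
  simpa using h.neg

namespace LaplaceCone

theorem exp_neg_mul_one_sub_exp_rpow {β : ℝ} (h0 : 0 ≤ β) (h1 : β ≤ 1) {T : ℝ} (hT : 0 ≤ T)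
    {s : ℝ} (hs : 0 < s) :
    LaplaceCone fun l => Real.exp (-T * (1 - Real.exp (-s * l)) ^ β) := by
  have hser : LaplaceCone fun l => 1 - (1 - Real.exp (-s * l)) ^ β := by
    have hlt : ∀ l > 0, Real.exp (-s * l) < 1 := fun l hl => by
      rw [Real.exp_lt_one_iff]
      nlinarith [mul_pos hs hl]
    refine of_hasSum (fun n => ((LaplaceCone.exp s hs.le).pow (n + 1)).const_mul _
      (neg_nonneg.2 (multichoose_neg_succ_nonpos h0 h1 n))) 1
      (fun l hl => hasSum_one_sub_one_sub_rpow β (Real.exp_pos _).le (hlt l hl)) fun l hl => ?_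
    linarith [Real.rpow_nonneg (sub_nonneg.2 (hlt l hl).le) β]
  convert ((hser.const_mul T hT).exp_comp).const_mul (Real.exp (-T)) (Real.exp_pos _).le using 2
    with l
  rw [← Real.exp_add]
  ring_nf

theorem exp_neg_mul_rpow {β : ℝ} (h0 : 0 ≤ β) (h1 : β ≤ 1) {t : ℝ} (ht : 0 ≤ t) :
    LaplaceCone fun l => Real.exp (-t * l ^ β) := by
  refine LaplaceCone.lim 1 (fun n : ℕ => exp_neg_mul_one_sub_exp_rpow h0 h1
    (T := t * ((n : ℝ) + 1) ^ β) (by positivity) (s := ((n : ℝ) + 1)⁻¹) (by positivity))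
    (fun n l hl => ?_) fun l hl => ?_
  · rw [abs_of_pos (Real.exp_pos _), Real.exp_le_one_iff, neg_mul, neg_nonpos]
    have : Real.exp (-((n : ℝ) + 1)⁻¹ * l) ≤ 1 := by
      rw [Real.exp_le_one_iff, neg_mul, neg_nonpos]
      positivity
    have := Real.rpow_nonneg (sub_nonneg.2 this) β
    positivity
  · have hlim : Filter.Tendsto (fun n : ℕ => ((n : ℝ) + 1) * (1 - Real.exp (-((n : ℝ) + 1)⁻¹ * l)))
        Filter.atTop (nhds l) := by
      have hd : HasDerivAt (fun s : ℝ => 1 - Real.exp (-s * l)) l 0 := by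
        have := (((hasDerivAt_id (0 : ℝ)).neg.mul_const l).exp).const_sub 1
        simpa using this
      have hz : Filter.Tendsto (fun n : ℕ => ((n : ℝ) + 1)⁻¹) Filter.atTop (nhdsWithin 0 {0}ᶜ) := by
        refine tendsto_nhdsWithin_iff.2 ⟨?_, Filter.Eventually.of_forall fun n => ?_⟩
        · simpa using tendsto_one_div_add_atTop_nhds_zero_nat (𝕜 := ℝ)
        · have : ((n : ℝ) + 1)⁻¹ ≠ 0 := by positivity
          simpa using this
      convert hd.tendsto_slope.comp hz using 2 with n
      simp [slope_def_field, div_eq_mul_inv, mul_comm]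
    have hr := hlim.rpow_const (p := β) (Or.inl hl.ne')
    refine ((Real.continuous_exp.tendsto _).comp (hr.const_mul (-t))).congr fun n => ?_
    have : 0 ≤ 1 - Real.exp (-((n : ℝ) + 1)⁻¹ * l) := by
      rw [sub_nonneg, Real.exp_le_one_iff, neg_mul, neg_nonpos]
      positivity
    simp only [Function.comp_apply]
    rw [Real.mul_rpow (by positivity) this]
    ring_nf

theorem aestronglyMeasurable_comp_sq {φ : ℝ → ℝ} (h : LaplaceCone φ) :
    AEStronglyMeasurable (fun ξ : ℝ => φ (ξ ^ 2)) := by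
  induction h with
  | exp s hs => exact Continuous.aestronglyMeasurable (by fun_prop)
  | add _ _ h₁ h₂ => exact h₁.add h₂
  | const_mul c hc _ h => exact h.const_mul c
  | lim C _ _ ht h =>
    refine aestronglyMeasurable_of_tendsto_ae Filter.atTop h ?_
    filter_upwards [Measure.ae_ne volume 0] with ξ hξ using ht _ (by positivity)

theorem integrable_cos_mul {φ : ℝ → ℝ} (h : LaplaceCone φ) {ε : ℝ} (hε : 0 < ε) (y : ℝ) :
    Integrable fun ξ : ℝ => Real.cos (ξ * y) * φ (ξ ^ 2) * Real.exp (-ε * ξ ^ 2) := by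
  obtain ⟨C, hC⟩ := h.bounded
  refine (integrable_exp_neg_mul_sq hε).bdd_mul (c := C) ((Continuous.aestronglyMeasurable
    (by fun_prop)).mul h.aestronglyMeasurable_comp_sq) ?_
  filter_upwards [Measure.ae_ne volume 0] with ξ hξ
  rw [Real.norm_eq_abs, abs_mul]
  exact (mul_le_of_le_one_left (abs_nonneg _) (Real.abs_cos_le_one _)).trans (hC _ (by positivity))

end LaplaceCone

theorem integral_cos_mul_exp_neg_mul_sq {b : ℝ} (hb : 0 < b) (y : ℝ) :
    ∫ ξ : ℝ, Real.cos (ξ * y) * Real.exp (-b * ξ ^ 2) =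
      √(π / b) * Real.exp (-(4 * b)⁻¹ * y ^ 2) := by
  have h := fourierIntegral_gaussian (b := (b : ℂ)) (by simpa using hb) (y : ℂ)
  have hint : Integrable fun ξ : ℝ =>
      Complex.exp (Complex.I * y * ξ) * Complex.exp (-b * (ξ : ℂ) ^ 2) := by
    refine (integrable_cexp_neg_mul_sq (b := (b : ℂ)) (by simpa using hb)).bdd_mul (c := 1)
      (Continuous.aestronglyMeasurable (by fun_prop)) (Filter.Eventually.of_forall fun ξ => ?_)
    rw [Complex.norm_exp]
    simp
  have hre := congrArg Complex.re h
  rw [← RCLike.re_eq_complex_re, ← integral_re hint] at hre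
  have hpow : ((π : ℂ) / b) ^ (1 / 2 : ℂ) = (√(π / b) : ℝ) := by
    rw [Real.sqrt_eq_rpow, Complex.ofReal_cpow (by positivity)]
    push_cast
    rfl
  rw [hpow] at hre
  convert hre using 1
  · refine integral_congr_ae (Filter.Eventually.of_forall fun ξ => ?_)
    have e1 : Complex.I * y * ξ = ((ξ * y : ℝ) : ℂ) * Complex.I := by push_cast; ring
    have e2 : -(b : ℂ) * (ξ : ℂ) ^ 2 = ((-b * ξ ^ 2 : ℝ) : ℂ) := by push_cast; ring
    simp only [e1, e2, RCLike.re_eq_complex_re]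
    rw [← Complex.ofReal_exp, Complex.re_mul_ofReal, Complex.exp_ofReal_mul_I_re]
  · have e : -(y : ℂ) ^ 2 / (4 * b) = ((-(4 * b)⁻¹ * y ^ 2 : ℝ) : ℂ) := by
      push_cast
      field_simp
    rw [e, ← Complex.ofReal_exp, ← Complex.ofReal_mul, RCLike.re_eq_complex_re, Complex.ofReal_re]

/-- Cosine transforms of members of the cone are symmetric unimodal, being limits of mixtures of
centred Gaussians. -/
theorem LaplaceCone.symmUnimodal {φ : ℝ → ℝ} (h : LaplaceCone φ) {ε : ℝ} (hε : 0 < ε) :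
    SymmUnimodal fun y => ∫ ξ : ℝ, Real.cos (ξ * y) * φ (ξ ^ 2) * Real.exp (-ε * ξ ^ 2) := by
  induction h with
  | exp s hs =>
    have hb : 0 < s + ε := by positivity
    have e : ∀ y : ℝ, ∫ ξ : ℝ, Real.cos (ξ * y) * Real.exp (-s * ξ ^ 2) * Real.exp (-ε * ξ ^ 2) =
        √(π / (s + ε)) * Real.exp (-(4 * (s + ε))⁻¹ * y ^ 2) := by
      intro y
      rw [← integral_cos_mul_exp_neg_mul_sq hb]
      congr 1 with ξ
      rw [mul_assoc, ← Real.exp_add]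
      ring_nf
    simp only [e]
    refine ⟨fun y => by positivity, fun y => by simp, fun x hx y _ hxy => ?_⟩
    refine mul_le_mul_of_nonneg_left (Real.exp_le_exp.2 ?_) (Real.sqrt_nonneg _)
    have hx0 : 0 ≤ x := hx
    have : (4 * (s + ε))⁻¹ * x ^ 2 ≤ (4 * (s + ε))⁻¹ * y ^ 2 := by gcongr
    linarith
  | add h₁ h₂ ih₁ ih₂ =>
    convert ih₁.add ih₂ using 2 with y
    rw [← integral_add (h₁.integrable_cos_mul hε y) (h₂.integrable_cos_mul hε y)]
    congr 1 with ξ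
    ring
  | const_mul c hc _ ih =>
    convert ih.const_mul hc using 2 with y
    rw [← integral_const_mul]
    congr 1 with ξ
    ring
  | lim C hφ hb ht ih =>
    refine SymmUnimodal.of_tendsto ih fun y => ?_
    refine tendsto_integral_of_dominated_convergence (fun ξ => C * Real.exp (-ε * ξ ^ 2))
      (fun n => ((hφ n).integrable_cos_mul hε y).aestronglyMeasurable)
      ((integrable_exp_neg_mul_sq hε).const_mul C) (fun n => ?_) ?_
    · filter_upwards [Measure.ae_ne volume 0] with ξ hξ
      rw [Real.norm_eq_abs, abs_mul, abs_mul, abs_of_pos (Real.exp_pos _)]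
      refine mul_le_mul_of_nonneg_right ?_ (Real.exp_pos _).le
      exact (mul_le_of_le_one_left (abs_nonneg _) (Real.abs_cos_le_one _)).trans
        (hb n _ (by positivity))
    · filter_upwards [Measure.ae_ne volume 0] with ξ hξ
      exact ((ht _ (by positivity)).const_mul _).mul_const _

theorem integrable_exp_neg_mul_abs_rpow {α t : ℝ} (hα : 0 < α) (ht : 0 < t) :
    Integrable fun ξ : ℝ => Real.exp (-t * |ξ| ^ α) := by
  have hpos : IntegrableOn (fun ξ : ℝ => Real.exp (-t * |ξ| ^ α)) (Set.Ioi 0) := by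
    refine (integrableOn_rpow_mul_exp_neg_mul_rpow (s := 0) (by norm_num) hα ht).congr_fun
      (fun ξ hξ => ?_) measurableSet_Ioi
    simp [abs_of_pos (Set.mem_Ioi.1 hξ)]
  rw [← integrableOn_univ, ← Set.Iic_union_Ioi (a := (0 : ℝ)), integrableOn_union]
  refine ⟨?_, hpos⟩
  rw [integrableOn_Iic_iff_integrableOn_Iio]
  have := ((Measure.measurePreserving_neg (volume : Measure ℝ)).integrableOn_comp_preimage
    (MeasurableEquiv.neg ℝ).measurableEmbedding).2 hpos
  simpa [Function.comp_def] using this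

theorem continuous_stableDensity {α t : ℝ} (hα : 0 < α) (ht : 0 < t) :
    Continuous (stableDensity α t) := by
  refine continuous_const.mul (continuous_of_dominated (F := fun y ξ : ℝ =>
    Real.cos (ξ * y) * Real.exp (-t * |ξ| ^ α)) (bound := fun ξ => Real.exp (-t * |ξ| ^ α))
    (fun y => ?_) (fun y => ?_) (integrable_exp_neg_mul_abs_rpow hα ht) ?_)
  · exact (Continuous.aestronglyMeasurable (by fun_prop)).mul
      (integrable_exp_neg_mul_abs_rpow hα ht).aestronglyMeasurable
  · refine Filter.Eventually.of_forall fun ξ => ?_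
    rw [Real.norm_eq_abs, abs_mul, abs_of_pos (Real.exp_pos _)]
    exact mul_le_of_le_one_left (Real.exp_pos _).le (Real.abs_cos_le_one _)
  · exact Filter.Eventually.of_forall fun ξ => by fun_prop

/-- The symmetric stable densities are symmetric unimodal. -/
theorem symmUnimodal_stableDensity {α t : ℝ} (hα0 : 0 < α) (hα2 : α ≤ 2) (ht : 0 < t) :
    SymmUnimodal (stableDensity α t) := by
  have hcone := LaplaceCone.exp_neg_mul_rpow (β := α / 2) (by positivity) (by linarith) ht.le
  refine SymmUnimodal.const_mul (q := fun y => ∫ ξ : ℝ, Real.cos (ξ * y) *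
    Real.exp (-t * |ξ| ^ α)) ?_ (by positivity)
  refine SymmUnimodal.of_tendsto
    (fun n : ℕ => hcone.symmUnimodal (ε := 1 / ((n : ℝ) + 1)) (by positivity)) fun y => ?_
  have hsq : ∀ ξ : ℝ, (ξ ^ 2) ^ (α / 2) = |ξ| ^ α := fun ξ => by
    rw [← sq_abs, ← Real.rpow_natCast, ← Real.rpow_mul (abs_nonneg ξ)]
    congr 1
    push_cast
    ring
  simp only [hsq]
  refine tendsto_integral_of_dominated_convergence (fun ξ => Real.exp (-t * |ξ| ^ α))
    (fun n => ?_) (integrable_exp_neg_mul_abs_rpow hα0 ht)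
    (fun n => Filter.Eventually.of_forall fun ξ => ?_) (Filter.Eventually.of_forall fun ξ => ?_)
  · exact ((Continuous.aestronglyMeasurable (by fun_prop)).mul
      (integrable_exp_neg_mul_abs_rpow hα0 ht).aestronglyMeasurable).mul
      (Continuous.aestronglyMeasurable (by fun_prop))
  · rw [Real.norm_eq_abs, abs_mul, abs_mul, abs_of_pos (Real.exp_pos _),
      abs_of_pos (Real.exp_pos _)]
    have h1 : Real.exp (-(1 / ((n : ℝ) + 1)) * ξ ^ 2) ≤ 1 := by
      rw [Real.exp_le_one_iff, neg_mul, neg_nonpos]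
      positivity
    exact (mul_le_of_le_one_right (by positivity) h1).trans
      (mul_le_of_le_one_left (Real.exp_pos _).le (Real.abs_cos_le_one _))
  · have h0 : Filter.Tendsto (fun n : ℕ => Real.exp (-(1 / ((n : ℝ) + 1)) * ξ ^ 2)) Filter.atTop
        (nhds 1) := by
      have := ((tendsto_one_div_add_atTop_nhds_zero_nat (𝕜 := ℝ)).neg.mul_const (ξ ^ 2))
      simpa [Function.comp_def] using (Real.continuous_exp.tendsto _).comp this
    simpa using h0.const_mul (Real.cos (ξ * y) * Real.exp (-t * |ξ| ^ α))

/-- `F` is concave on `(-a/2, a/2)`, nondecreasing on `(-a, 0)` and nonincreasing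
on `(0, a)`. -/
theorem stable_fdd_mid_concave (n : ℕ) (hn : 0 < n) (α : ℝ) (hα0 : 0 < α) (hα2 : α ≤ 2)
    (a : ℝ) (ha : 0 < a) (t : Fin n → ℝ) (ht : ∀ i, 0 < t i) (htm : StrictMono t) :
    ConcaveOn ℝ (Set.Ioo (-(a / 2)) (a / 2)) (stableFDD n α a t) ∧
    MonotoneOn (stableFDD n α a t) (Set.Ioo (-a) (0 : ℝ)) ∧
    AntitoneOn (stableFDD n α a t) (Set.Ioo (0 : ℝ) a) := by
  have hinc : ∀ i : Fin n, 0 < (Fin.cons 0 t : Fin (n + 1) → ℝ) i.succ -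
      (Fin.cons 0 t : Fin (n + 1) → ℝ) i.castSucc := by
    intro i
    obtain ⟨m, rfl⟩ : ∃ m, n = m + 1 := ⟨n - 1, by omega⟩
    cases i using Fin.cases with
    | zero => simpa using ht 0
    | succ j => simpa [← Fin.succ_castSucc] using htm j.castSucc_lt_succ
  obtain ⟨hc, hmid⟩ : Continuous (stableFDD n α a t) ∧ MidUnimodal a (stableFDD n α a t) :=
    continuous_and_midUnimodal_boxPathIntegral ha _
      (fun i => continuous_stableDensity hα0 (hinc i))
      fun i => symmUnimodal_stableDensity hα0 hα2 (hinc i)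
  have hanti := hmid.antitoneOn ha
  refine ⟨concaveOn_Ioo_of_midpoint hc fun x hx w _ _ => ?_, fun x hx y hy hxy => ?_,
    hanti.mono fun x hx => hx.1.le⟩
  · have habs : |x| ≤ a / 2 := abs_le.2 ⟨hx.1.le, hx.2.le⟩
    have h := (hmid.symmUnimodal |x| (abs_nonneg x) habs).le_of_abs_le
      (x := 0) (y := w) (by simp)
    simp only [add_zero, sub_zero] at h
    rcases abs_choice x with hx' | hx' <;> rw [hx'] at h
    · linarith
    · have e1 := hmid.even (x + w)
      have e2 := hmid.even (x - w)
      rw [neg_add, ← sub_eq_add_neg] at e1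
      rw [neg_sub, sub_eq_neg_add] at e2
      rw [hmid.even] at h
      linarith
  · rw [← hmid.even x, ← hmid.even y]
    exact hanti (by simpa using hy.2.le) (by simpa using hx.2.le) (by linarith)
end

section
/- Let d ≥ 1, let 0 < α ≤ 2, let Q = (-a_1, a_1) × ⋯ × (-a_d, a_d) with all a_j > 0, and let 0 < t_1 < ⋯ < t_n. Define F : ℝ^d → ℝ by F(x) = ∫_Q ⋯ ∫_Q ∏_{i=1}^{n} q^α_{t_i - t_{i-1}}(x_{i-1} - x_i) dx_1 ⋯ dx_n, where x_0 = x and t_0 = 0. Then for every coordinate index j and every fixed choice of the other coordinates (x_k)_{k ≠ j} with x_k ∈ (-a_k, a_k), the function x_j ↦ F(x) is concave on (-a_j/2, a_j/2), is nondecreasing on (-a_j, 0), and is nonincreasing on (0, a_j); that is, F is mid-concave on Q and satisfies ∂F/∂x_j ≥ 0 when x_j < 0 and ∂F/∂x_j ≤ 0 when x_j > 0. -/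
open MeasureTheory Real

/-- The density of the `d`-dimensional rotationally symmetric `α`-stable process at time `t`,
defined by Fourier inversion:
`q^α_t(y) = (2π)^{-d} ∫_{ℝ^d} cos(⟨ξ, y⟩) e^{-t‖ξ‖^α} dξ`. -/
noncomputable def stableDensityD (d : ℕ) (α t : ℝ) (y : Fin d → ℝ) : ℝ :=
  ((2 * Real.pi) ^ d)⁻¹ *
    ∫ ξ : Fin d → ℝ,
      Real.cos (∑ j, ξ j * y j) * Real.exp (-t * (Real.sqrt (∑ j, ξ j ^ 2)) ^ α)

/-- `F(x) = ∫_Q ⋯ ∫_Q ∏_{i=1}^{n} q^α_{t_i - t_{i-1}}(x_{i-1} - x_i) dx_1 ⋯ dx_n`,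
with `x_0 = x`, `t_0 = 0` and `Q = ∏_j (-a_j, a_j)`.  This is the finite-dimensional
distribution `P_x{X^α_{t_1} ∈ Q, ..., X^α_{t_n} ∈ Q}` of the symmetric `α`-stable process. -/
noncomputable def stableFDDd (d n : ℕ) (α : ℝ) (a : Fin d → ℝ) (t : Fin n → ℝ)
    (x : Fin d → ℝ) : ℝ :=
  ∫ y in {y : Fin n → Fin d → ℝ | ∀ i j, y i j ∈ Set.Ioo (-(a j)) (a j)},
    ∏ i : Fin n,
      stableDensityD d α
        ((Fin.cons 0 t : Fin (n + 1) → ℝ) i.succ - (Fin.cons 0 t : Fin (n + 1) → ℝ) i.castSucc)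
        ((Fin.cons x y : Fin (n + 1) → Fin d → ℝ) i.castSucc -
          (Fin.cons x y : Fin (n + 1) → Fin d → ℝ) i.succ)

/-- The cone of functions on `(0, ∞)` generated by the exponentials `r ↦ exp (-s r)`, `s ≥ 0`,
under bounded pointwise limits. -/
inductive ExpMixture : (ℝ → ℝ) → Prop
  | exp (s : ℝ) (hs : 0 ≤ s) : ExpMixture (fun r => Real.exp (-(s * r)))
  | add {f g : ℝ → ℝ} : ExpMixture f → ExpMixture g → ExpMixture (fun r => f r + g r)
  | smul {f : ℝ → ℝ} (c : ℝ) (hc : 0 ≤ c) : ExpMixture f → ExpMixture (fun r => c * f r)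
  | lim {f : ℕ → ℝ → ℝ} {g : ℝ → ℝ} (C : ℝ) : (∀ n, ExpMixture (f n)) →
      (∀ n r, 0 < r → f n r ≤ C) →
      (∀ r, 0 < r → Filter.Tendsto (fun n => f n r) Filter.atTop (nhds (g r))) → ExpMixture g

namespace ExpMixture

lemma exists_bound {f : ℝ → ℝ} (hf : ExpMixture f) :
    ∃ C, 0 ≤ C ∧ ∀ r, 0 < r → 0 ≤ f r ∧ f r ≤ C := by
  induction hf with
  | exp s hs =>
    refine ⟨1, zero_le_one, fun r hr => ⟨(Real.exp_pos _).le, ?_⟩⟩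
    rw [Real.exp_le_one_iff]
    have := mul_nonneg hs hr.le
    linarith
  | add _ _ h₁ h₂ =>
    obtain ⟨C, hC, h₁⟩ := h₁
    obtain ⟨D, hD, h₂⟩ := h₂
    exact ⟨C + D, by positivity, fun r hr =>
      ⟨add_nonneg (h₁ r hr).1 (h₂ r hr).1, add_le_add (h₁ r hr).2 (h₂ r hr).2⟩⟩
  | smul c hc _ h =>
    obtain ⟨C, hC, h⟩ := h
    exact ⟨c * C, by positivity, fun r hr =>
      ⟨mul_nonneg hc (h r hr).1, mul_le_mul_of_nonneg_left (h r hr).2 hc⟩⟩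
  | @lim _ g C _ hb ht h =>
    have key : ∀ r : ℝ, 0 < r → 0 ≤ g r ∧ g r ≤ C := fun r hr =>
      ⟨ge_of_tendsto' (ht r hr) fun n => by
        obtain ⟨_, _, h'⟩ := h n
        exact (h' r hr).1, le_of_tendsto' (ht r hr) fun n => hb n r hr⟩
    exact ⟨C, (key 1 one_pos).1.trans (key 1 one_pos).2, key⟩

lemma congr {f g : ℝ → ℝ} (hf : ExpMixture f) (h : ∀ r, 0 < r → f r = g r) : ExpMixture g := by
  obtain ⟨C, -, hC⟩ := hf.exists_bound
  refine lim (f := fun _ => f) C (fun _ => hf) (fun _ r hr => (hC r hr).2) fun r hr => ?_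
  rw [h r hr]
  exact tendsto_const_nhds

lemma mul {f g : ℝ → ℝ} (hf : ExpMixture f) (hg : ExpMixture g) :
    ExpMixture (fun r => f r * g r) := by
  induction hf with
  | exp s hs =>
    induction hg with
    | exp s' hs' =>
      refine (exp (s + s') (add_nonneg hs hs')).congr fun r _ => ?_
      rw [← Real.exp_add]
      ring_nf
    | add _ _ h₁ h₂ => exact (h₁.add h₂).congr fun r _ => by ring
    | smul c hc _ h => exact (h.smul c hc).congr fun r _ => by ring
    | lim C _ hb ht h =>
      refine lim (f := fun n r => _) (max C 0) h (fun n r hr => ?_)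
        fun r hr => (ht r hr).const_mul _
      have h1 : Real.exp (-(s * r)) ≤ 1 := by
        rw [Real.exp_le_one_iff]
        have := mul_nonneg hs hr.le
        linarith
      calc Real.exp (-(s * r)) * _ ≤ Real.exp (-(s * r)) * max C 0 :=
            mul_le_mul_of_nonneg_left ((hb n r hr).trans (le_max_left _ _)) (Real.exp_pos _).le
        _ ≤ 1 * max C 0 := mul_le_mul_of_nonneg_right h1 (le_max_right _ _)
        _ = max C 0 := one_mul _
  | add _ _ h₁ h₂ => exact (h₁.add h₂).congr fun r _ => by ring
  | smul c hc _ h => exact (h.smul c hc).congr fun r _ => by ring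
  | lim C _ hb ht h =>
    obtain ⟨D, hD, hg⟩ := hg.exists_bound
    refine lim (f := fun n r => _) (max C 0 * D) h (fun n r hr => ?_)
      fun r hr => (ht r hr).mul_const _
    exact mul_le_mul ((hb n r hr).trans (le_max_left _ _)) (hg r hr).2 (hg r hr).1
      (le_max_right _ _)

lemma const {c : ℝ} (hc : 0 ≤ c) : ExpMixture (fun _ => c) :=
  ((exp 0 le_rfl).smul c hc).congr fun r _ => by simp

lemma pow {f : ℝ → ℝ} (hf : ExpMixture f) (n : ℕ) : ExpMixture (fun r => f r ^ n) := by
  induction n with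
  | zero => simpa using const zero_le_one
  | succ n ih => simpa only [pow_succ] using ih.mul hf

lemma finset_sum {ι : Type*} (s : Finset ι) {f : ι → ℝ → ℝ} (hf : ∀ i ∈ s, ExpMixture (f i)) :
    ExpMixture (fun r => ∑ i ∈ s, f i r) := by
  classical
  induction s using Finset.induction_on with
  | empty => simpa using const le_rfl
  | insert i s hi ih =>
    simp only [Finset.sum_insert hi]
    exact (hf i (Finset.mem_insert_self _ _)).add
      (ih fun j hj => hf j (Finset.mem_insert_of_mem hj))

lemma exp_comp {f : ℝ → ℝ} (hf : ExpMixture f) : ExpMixture (fun r => Real.exp (f r)) := by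
  obtain ⟨C, -, hC⟩ := hf.exists_bound
  refine lim (f := fun N r => ∑ k ∈ Finset.range N, (k.factorial : ℝ)⁻¹ * f r ^ k) (Real.exp C)
    (fun N => finset_sum _ fun k _ => (hf.pow k).smul _ (by positivity)) (fun N r hr => ?_)
    fun r _ => ?_
  · refine le_trans ?_ (Real.exp_le_exp.2 (hC r hr).2)
    refine le_trans (le_of_eq ?_) (Real.sum_le_exp_of_nonneg (hC r hr).1 N)
    exact Finset.sum_congr rfl fun k _ => by rw [div_eq_inv_mul]
  · have := (NormedSpace.expSeries_div_hasSum_exp (𝔸 := ℝ) (f r)).tendsto_sum_nat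
    rw [← Real.exp_eq_exp_ℝ] at this
    simpa only [div_eq_inv_mul] using this

end ExpMixture

lemma neg_one_pow_mul_choose_nonpos {β : ℝ} (h0 : 0 ≤ β) (h1 : β ≤ 1) (k : ℕ) :
    (-1) ^ (k + 1) * Ring.choose β (k + 1) ≤ 0 := by
  have step : ∀ k : ℕ, Ring.choose β (k + 1) = Ring.choose β k * ((β - k) / (k + 1)) := by
    intro k
    rw [Ring.choose_eq_smul, Ring.choose_eq_smul, descPochhammer_succ_right,
      Polynomial.smeval_mul, Nat.factorial_succ]
    simp [Polynomial.smeval_sub, Polynomial.smeval_X, Polynomial.smeval_natCast]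
    field_simp
  induction k with
  | zero => simp [h0]
  | succ k ih =>
    rw [step (k + 1), pow_succ]
    have : 0 ≤ ((k + 1 : ℕ) - β) / (((k + 1 : ℕ) : ℝ) + 1) := by
      apply div_nonneg _ (by positivity)
      push_cast
      have : (0 : ℝ) ≤ k := Nat.cast_nonneg k
      linarith
    have h2 := mul_nonpos_of_nonpos_of_nonneg ih this
    refine le_of_eq_of_le ?_ h2
    ring

lemma hasSum_one_sub_rpow (β : ℝ) {r : ℝ} (h0 : 0 ≤ r) (h1 : r < 1) :
    HasSum (fun k : ℕ => -((-1) ^ (k + 1) * Ring.choose β (k + 1)) * r ^ (k + 1))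
      (1 - (1 - r) ^ β) := by
  have h := (one_add_rpow_hasFPowerSeriesOnBall_zero (a := β)).hasSum (y := -r) (by
    simp [abs_of_nonneg h0, h1, enorm_eq_nnnorm, ← NNReal.coe_lt_coe])
  simp only [binomialSeries_apply, zero_add] at h
  have h2 := ((hasSum_nat_add_iff' 1).2 h).neg
  simp only [List.ofFn_const, List.prod_replicate, smul_eq_mul, Finset.sum_range_one,
    Ring.choose_zero_right, pow_zero, mul_one, neg_sub] at h2
  rw [sub_eq_add_neg 1 r]
  refine h2.congr_fun fun k => ?_
  rw [neg_pow r]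
  ring

namespace ExpMixture

lemma exp_neg_one_sub_rpow {β : ℝ} (h0 : 0 ≤ β) (h1 : β ≤ 1) {s T : ℝ} (hs : 0 < s)
    (hT : 0 ≤ T) : ExpMixture (fun r => Real.exp (-(T * (1 - Real.exp (-(s * r))) ^ β))) := by
  have hc : ∀ k : ℕ, 0 ≤ -((-1) ^ (k + 1) * Ring.choose β (k + 1)) := fun k =>
    neg_nonneg.2 (neg_one_pow_mul_choose_nonpos h0 h1 k)
  have hS : ∀ r, 0 < r → HasSum (fun k : ℕ => -((-1) ^ (k + 1) * Ring.choose β (k + 1)) *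
      Real.exp (-(s * r)) ^ (k + 1)) (1 - (1 - Real.exp (-(s * r))) ^ β) := fun r hr =>
    hasSum_one_sub_rpow β (Real.exp_pos _).le (by
      rw [Real.exp_lt_one_iff]
      have := mul_pos hs hr
      linarith)
  refine lim (f := fun N r => Real.exp (-T) * Real.exp (T * ∑ k ∈ Finset.range N,
    -((-1) ^ (k + 1) * Ring.choose β (k + 1)) * Real.exp (-(s * r)) ^ (k + 1))) 1
    (fun N => ?_) (fun N r hr => ?_) fun r hr => ?_
  · exact (exp_comp ((finset_sum _ fun k _ => ((exp s hs.le).pow (k + 1)).smul _ (hc k)).smul T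
      hT)).smul _ (Real.exp_pos _).le
  · rw [← Real.exp_add, Real.exp_le_one_iff]
    have hle : ∑ k ∈ Finset.range N,
        -((-1) ^ (k + 1) * Ring.choose β (k + 1)) * Real.exp (-(s * r)) ^ (k + 1) ≤ 1 := by
      refine (sum_le_hasSum _ (fun k _ => mul_nonneg (hc k) (by positivity)) (hS r hr)).trans ?_
      have : 0 ≤ (1 - Real.exp (-(s * r))) ^ β := by
        apply Real.rpow_nonneg
        rw [sub_nonneg, Real.exp_le_one_iff]
        have := mul_pos hs hr
        linarith
      linarith
    nlinarith
  · have h := ((hS r hr).tendsto_sum_nat.const_mul T).rexp.const_mul (Real.exp (-T))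
    rw [← Real.exp_add] at h
    convert h using 3
    ring

lemma exp_neg_rpow {β : ℝ} (h0 : 0 < β) (h1 : β ≤ 1) {T : ℝ} (hT : 0 ≤ T) :
    ExpMixture (fun r => Real.exp (-(T * r ^ β))) := by
  have hpos : ∀ n : ℕ, (0 : ℝ) < 1 / ((n : ℝ) + 1) := fun n => by positivity
  refine lim (f := fun n r => Real.exp (-((T * (1 / ((n : ℝ) + 1)) ^ (-β)) *
    (1 - Real.exp (-(1 / ((n : ℝ) + 1) * r))) ^ β))) 1
    (fun n => exp_neg_one_sub_rpow h0.le h1 (hpos n)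
      (mul_nonneg hT (Real.rpow_nonneg (hpos n).le _))) (fun n r hr => ?_) fun r hr => ?_
  · have : 0 ≤ 1 - Real.exp (-(1 / ((n : ℝ) + 1) * r)) := by
      rw [sub_nonneg, Real.exp_le_one_iff]
      have := mul_pos (hpos n) hr
      linarith
    rw [Real.exp_le_one_iff, neg_nonpos]
    exact mul_nonneg (mul_nonneg hT (Real.rpow_nonneg (hpos n).le _)) (Real.rpow_nonneg this _)
  · have hd : HasDerivAt (fun s : ℝ => 1 - Real.exp (-(s * r))) r 0 := by
      have := (((hasDerivAt_id (0 : ℝ)).mul_const r).neg.exp).const_sub 1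
      simpa using this
    have hs : Filter.Tendsto (fun n : ℕ => 1 / ((n : ℝ) + 1)) Filter.atTop (nhdsWithin 0 {0}ᶜ) :=
      tendsto_nhdsWithin_iff.2 ⟨tendsto_one_div_add_atTop_nhds_zero_nat,
        Filter.Eventually.of_forall fun n => (hpos n).ne'⟩
    have h2 := hd.tendsto_slope.comp hs
    have h3 := (((h2.rpow_const (p := β) (Or.inl hr.ne')).const_mul T).neg).rexp
    refine h3.congr fun n => ?_
    have : 0 ≤ 1 - Real.exp (-(1 / ((n : ℝ) + 1) * r)) := by
      rw [sub_nonneg, Real.exp_le_one_iff]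
      have := mul_pos (hpos n) hr
      linarith
    simp only [Function.comp, slope_def_field, sub_zero, zero_mul, neg_zero, Real.exp_zero,
      sub_self]
    rw [Real.div_rpow this (hpos n).le, Real.rpow_neg (hpos n).le]
    ring_nf

end ExpMixture

lemma integral_cos_mul_exp_neg_sq {d : ℕ} {b : ℝ} (hb : 0 < b) (y : Fin d → ℝ) :
    ∫ ξ : Fin d → ℝ, Real.cos (∑ j, ξ j * y j) * Real.exp (-(b * ∑ j, ξ j ^ 2)) =
      (π / b) ^ ((d : ℝ) / 2) * Real.exp (-((∑ j, y j ^ 2) / (4 * b))) := by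
  have hb' : 0 < (b : ℂ).re := by simpa using hb
  have hI := GaussianFourier.integrable_cexp_neg_mul_sum_add hb' (fun j => Complex.I * (y j : ℂ))
  have h := GaussianFourier.integral_cexp_neg_mul_sum_add hb' (fun j => Complex.I * (y j : ℂ))
  have hre := congrArg Complex.re h
  rw [← RCLike.re_eq_complex_re, ← integral_re hI] at hre
  have hL : ∀ ξ : Fin d → ℝ, RCLike.re (Complex.exp (-(b : ℂ) * ∑ i, (ξ i : ℂ) ^ 2 +
      ∑ i, Complex.I * (y i : ℂ) * ξ i)) =
      Real.cos (∑ j, ξ j * y j) * Real.exp (-(b * ∑ j, ξ j ^ 2)) := by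
    intro ξ
    have : -(b : ℂ) * ∑ i, (ξ i : ℂ) ^ 2 + ∑ i, Complex.I * (y i : ℂ) * ξ i =
        ((-(b * ∑ j, ξ j ^ 2) : ℝ) : ℂ) + ((∑ j, ξ j * y j : ℝ) : ℂ) * Complex.I := by
      push_cast
      rw [Finset.sum_mul]
      congr 1
      · ring
      · exact Finset.sum_congr rfl fun i _ => by ring
    rw [this, RCLike.re_eq_complex_re, Complex.exp_add, ← Complex.ofReal_exp,
      Complex.re_ofReal_mul, Complex.exp_ofReal_mul_I_re, mul_comm]
  simp_rw [hL] at hre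
  rw [hre]
  have hR : (π / (b : ℂ)) ^ ((Fintype.card (Fin d) : ℂ) / 2) *
      Complex.exp ((∑ i, (Complex.I * (y i : ℂ)) ^ 2) / (4 * b)) =
      (((π / b) ^ ((d : ℝ) / 2) * Real.exp (-((∑ j, y j ^ 2) / (4 * b))) : ℝ) : ℂ) := by
    rw [Complex.ofReal_mul, Complex.ofReal_cpow (by positivity), Complex.ofReal_exp]
    push_cast
    simp only [mul_pow, Complex.I_sq, Fintype.card_fin, neg_mul, one_mul,
      Finset.sum_neg_distrib, neg_div]
  rw [RCLike.re_eq_complex_re, hR, Complex.ofReal_re]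

lemma integrable_exp_neg_mul_sum_sq {d : ℕ} {b : ℝ} (hb : 0 < b) :
    Integrable (fun ξ : Fin d → ℝ => Real.exp (-(b * ∑ j, ξ j ^ 2))) := by
  have h := (GaussianFourier.integrable_cexp_neg_mul_sum_add (ι := Fin d) (b := (b : ℂ))
    (by simpa using hb) 0).re
  refine h.congr (Filter.Eventually.of_forall fun ξ => ?_)
  have : -(b : ℂ) * ∑ i, (ξ i : ℂ) ^ 2 + ∑ i, (0 : Fin d → ℂ) i * ξ i =
      ((-(b * ∑ j, ξ j ^ 2) : ℝ) : ℂ) := by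
    push_cast
    simp
  simp only [this, RCLike.re_eq_complex_re]
  rw [← Complex.ofReal_exp, Complex.ofReal_re]

lemma ae_sum_sq_pos {d : ℕ} (hd : 0 < d) : ∀ᵐ ξ : Fin d → ℝ, 0 < ∑ j, ξ j ^ 2 := by
  have : Nonempty (Fin d) := ⟨⟨0, hd⟩⟩
  filter_upwards [compl_mem_ae_iff.2 (measure_singleton (0 : Fin d → ℝ))] with ξ hξ
  obtain ⟨i, hi⟩ := Function.ne_iff.1 (show ξ ≠ 0 from hξ)
  exact Finset.sum_pos' (fun j _ => sq_nonneg _) ⟨i, Finset.mem_univ _, sq_pos_of_ne_zero hi⟩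

namespace ExpMixture

lemma aestronglyMeasurable_comp_sum_sq {d : ℕ} (hd : 0 < d) {φ : ℝ → ℝ} (hφ : ExpMixture φ) :
    AEStronglyMeasurable (fun ξ : Fin d → ℝ => φ (∑ j, ξ j ^ 2)) := by
  induction hφ with
  | exp s hs =>
    exact Continuous.aestronglyMeasurable (by fun_prop)
  | add _ _ h₁ h₂ => exact h₁.add h₂
  | smul c hc _ h => exact h.const_mul c
  | lim C _ hb ht h =>
    refine aestronglyMeasurable_of_tendsto_ae Filter.atTop h ?_
    filter_upwards [ae_sum_sq_pos hd] with ξ hξ using ht _ hξ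

lemma integrable_cos_mul {d : ℕ} (hd : 0 < d) {φ : ℝ → ℝ} (hφ : ExpMixture φ) {ε : ℝ}
    (hε : 0 < ε) (y : Fin d → ℝ) :
    Integrable (fun ξ : Fin d → ℝ => Real.cos (∑ j, ξ j * y j) *
      (φ (∑ j, ξ j ^ 2) * Real.exp (-(ε * ∑ j, ξ j ^ 2)))) := by
  obtain ⟨C, -, hC⟩ := hφ.exists_bound
  refine ((integrable_exp_neg_mul_sum_sq hε).const_mul C).mono' ?_ ?_
  · exact (Continuous.aestronglyMeasurable (by fun_prop)).mul
      ((hφ.aestronglyMeasurable_comp_sum_sq hd).mul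
        (Continuous.aestronglyMeasurable (by fun_prop)))
  · filter_upwards [ae_sum_sq_pos hd] with ξ hξ
    rw [norm_mul, norm_mul, Real.norm_eq_abs, Real.norm_eq_abs, Real.norm_eq_abs,
      abs_of_nonneg (hC _ hξ).1, Real.abs_exp]
    calc _ ≤ 1 * (φ (∑ j, ξ j ^ 2) * Real.exp (-(ε * ∑ j, ξ j ^ 2))) :=
          mul_le_mul_of_nonneg_right (Real.abs_cos_le_one _)
            (mul_nonneg (hC _ hξ).1 (Real.exp_pos _).le)
      _ = φ (∑ j, ξ j ^ 2) * Real.exp (-(ε * ∑ j, ξ j ^ 2)) := one_mul _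
      _ ≤ _ := mul_le_mul_of_nonneg_right (hC _ hξ).2 (Real.exp_pos _).le

/-- Fourier transforms of mixtures of Gaussians are nonnegative and radially decreasing. -/
lemma integral_cos_mul_anti {d : ℕ} (hd : 0 < d) {φ : ℝ → ℝ} (hφ : ExpMixture φ) {ε : ℝ}
    (hε : 0 < ε) {y y' : Fin d → ℝ} (hy : ∑ j, y j ^ 2 ≤ ∑ j, y' j ^ 2) :
    0 ≤ ∫ ξ : Fin d → ℝ, Real.cos (∑ j, ξ j * y' j) *
      (φ (∑ j, ξ j ^ 2) * Real.exp (-(ε * ∑ j, ξ j ^ 2))) ∧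
    ∫ ξ : Fin d → ℝ, Real.cos (∑ j, ξ j * y' j) *
      (φ (∑ j, ξ j ^ 2) * Real.exp (-(ε * ∑ j, ξ j ^ 2))) ≤
    ∫ ξ : Fin d → ℝ, Real.cos (∑ j, ξ j * y j) *
      (φ (∑ j, ξ j ^ 2) * Real.exp (-(ε * ∑ j, ξ j ^ 2))) := by
  induction hφ with
  | exp s hs =>
    have hb : 0 < s + ε := by positivity
    have : ∀ y : Fin d → ℝ, ∫ ξ : Fin d → ℝ, Real.cos (∑ j, ξ j * y j) *
        (Real.exp (-(s * ∑ j, ξ j ^ 2)) * Real.exp (-(ε * ∑ j, ξ j ^ 2))) =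
        (π / (s + ε)) ^ ((d : ℝ) / 2) * Real.exp (-((∑ j, y j ^ 2) / (4 * (s + ε)))) := by
      intro y
      rw [← integral_cos_mul_exp_neg_sq hb]
      refine integral_congr_ae (Filter.Eventually.of_forall fun ξ => ?_)
      simp only [← Real.exp_add]
      ring_nf
    rw [this, this]
    refine ⟨by positivity, ?_⟩
    gcongr
  | @add f g hf hg h₁ h₂ =>
    have : ∀ y : Fin d → ℝ, ∫ ξ : Fin d → ℝ, Real.cos (∑ j, ξ j * y j) *
        ((f (∑ j, ξ j ^ 2) + g (∑ j, ξ j ^ 2)) * Real.exp (-(ε * ∑ j, ξ j ^ 2))) =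
        (∫ ξ : Fin d → ℝ, Real.cos (∑ j, ξ j * y j) *
          (f (∑ j, ξ j ^ 2) * Real.exp (-(ε * ∑ j, ξ j ^ 2)))) +
        ∫ ξ : Fin d → ℝ, Real.cos (∑ j, ξ j * y j) *
          (g (∑ j, ξ j ^ 2) * Real.exp (-(ε * ∑ j, ξ j ^ 2))) := by
      intro y
      rw [← integral_add (hf.integrable_cos_mul hd hε y) (hg.integrable_cos_mul hd hε y)]
      refine integral_congr_ae (Filter.Eventually.of_forall fun ξ => ?_)
      simp only
      ring
    rw [this, this]
    exact ⟨add_nonneg h₁.1 h₂.1, add_le_add h₁.2 h₂.2⟩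
  | @smul f c hc hf h =>
    have : ∀ y : Fin d → ℝ, ∫ ξ : Fin d → ℝ, Real.cos (∑ j, ξ j * y j) *
        (c * f (∑ j, ξ j ^ 2) * Real.exp (-(ε * ∑ j, ξ j ^ 2))) =
        c * ∫ ξ : Fin d → ℝ, Real.cos (∑ j, ξ j * y j) *
          (f (∑ j, ξ j ^ 2) * Real.exp (-(ε * ∑ j, ξ j ^ 2))) := by
      intro y
      rw [← integral_const_mul]
      refine integral_congr_ae (Filter.Eventually.of_forall fun ξ => ?_)
      simp only
      ring
    rw [this, this]
    exact ⟨mul_nonneg hc h.1, mul_le_mul_of_nonneg_left h.2 hc⟩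
  | @lim f g C hf hb ht h =>
    have key : ∀ y : Fin d → ℝ, Filter.Tendsto
        (fun n => ∫ ξ : Fin d → ℝ, Real.cos (∑ j, ξ j * y j) *
          (f n (∑ j, ξ j ^ 2) * Real.exp (-(ε * ∑ j, ξ j ^ 2)))) Filter.atTop
        (nhds (∫ ξ : Fin d → ℝ, Real.cos (∑ j, ξ j * y j) *
          (g (∑ j, ξ j ^ 2) * Real.exp (-(ε * ∑ j, ξ j ^ 2))))) := by
      intro y
      refine tendsto_integral_of_dominated_convergence
        (fun ξ => C * Real.exp (-(ε * ∑ j, ξ j ^ 2)))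
        (fun n => ((hf n).integrable_cos_mul hd hε y).aestronglyMeasurable)
        ((integrable_exp_neg_mul_sum_sq hε).const_mul C) (fun n => ?_) ?_
      · obtain ⟨_, -, hn⟩ := (hf n).exists_bound
        filter_upwards [ae_sum_sq_pos hd] with ξ hξ
        rw [norm_mul, norm_mul, Real.norm_eq_abs, Real.norm_eq_abs, Real.norm_eq_abs,
          abs_of_nonneg (hn _ hξ).1, Real.abs_exp]
        calc _ ≤ 1 * (f n (∑ j, ξ j ^ 2) * Real.exp (-(ε * ∑ j, ξ j ^ 2))) :=
              mul_le_mul_of_nonneg_right (Real.abs_cos_le_one _)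
                (mul_nonneg (hn _ hξ).1 (Real.exp_pos _).le)
          _ = f n (∑ j, ξ j ^ 2) * Real.exp (-(ε * ∑ j, ξ j ^ 2)) := one_mul _
          _ ≤ _ := mul_le_mul_of_nonneg_right (hb n _ hξ) (Real.exp_pos _).le
      · filter_upwards [ae_sum_sq_pos hd] with ξ hξ
        exact ((ht _ hξ).mul_const _).const_mul _
    exact ⟨ge_of_tendsto' (key y') fun n => (h n).1,
      le_of_tendsto_of_tendsto' (key y') (key y) fun n => (h n).2⟩

end ExpMixture

/-- A continuous nonnegative convolution kernel that is even and decreasing in each coordinate. -/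
structure IsUnimodalKernel {d : ℕ} (q : (Fin d → ℝ) → ℝ) : Prop where
  continuous : Continuous q
  nonneg : ∀ y, 0 ≤ q y
  anti : ∀ y y', (∀ k, |y k| ≤ |y' k|) → q y' ≤ q y

lemma integrable_exp_neg_mul_sum_sqrt_rpow {d : ℕ} (hd : 0 < d) {α t : ℝ} (hα : 0 < α)
    (ht : 0 < t) :
    Integrable (fun ξ : Fin d → ℝ => Real.exp (-t * (Real.sqrt (∑ j, ξ j ^ 2)) ^ α)) := by
  have : Nonempty (Fin d) := ⟨⟨0, hd⟩⟩
  have h : Integrable (fun ξ : Fin d → ℝ => Real.exp (-t * ‖ξ‖ ^ α)) := by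
    refine (integrable_fun_norm_addHaar (E := Fin d → ℝ) volume
      (f := fun r => Real.exp (-t * r ^ α))).2 ?_
    have := integrableOn_rpow_mul_exp_neg_mul_rpow (p := α) (b := t)
      (s := ((Module.finrank ℝ (Fin d → ℝ) - 1 : ℕ) : ℝ))
      (lt_of_lt_of_le (by norm_num) (Nat.cast_nonneg _)) hα ht
    simpa only [Real.rpow_natCast, smul_eq_mul] using this
  refine h.mono' ?_ (Filter.Eventually.of_forall fun ξ => ?_)
  · refine Continuous.aestronglyMeasurable ?_
    have : Continuous fun ξ : Fin d → ℝ => (Real.sqrt (∑ j, ξ j ^ 2)) ^ α :=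
      Continuous.rpow_const (by fun_prop) fun _ => Or.inr hα.le
    fun_prop
  · rw [Real.norm_eq_abs, Real.abs_exp, Real.exp_le_exp, neg_mul, neg_mul, neg_le_neg_iff]
    refine mul_le_mul_of_nonneg_left (Real.rpow_le_rpow (norm_nonneg _) ?_ hα.le) ht.le
    refine (pi_norm_le_iff_of_nonneg (Real.sqrt_nonneg _)).2 fun i => ?_
    rw [Real.norm_eq_abs]
    refine Real.abs_le_sqrt ?_
    exact Finset.single_le_sum (f := fun j => ξ j ^ 2) (fun j _ => sq_nonneg _)
      (Finset.mem_univ i)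

lemma tendsto_integral_cos_mul_exp {d : ℕ} (hd : 0 < d) {α t : ℝ} (hα : 0 < α)
    (ht : 0 < t) (y : Fin d → ℝ) :
    Filter.Tendsto (fun n : ℕ => ∫ ξ : Fin d → ℝ, Real.cos (∑ j, ξ j * y j) *
      (Real.exp (-(t * (∑ j, ξ j ^ 2) ^ (α / 2))) *
        Real.exp (-((1 / ((n : ℝ) + 1)) * ∑ j, ξ j ^ 2)))) Filter.atTop
      (nhds (∫ ξ : Fin d → ℝ, Real.cos (∑ j, ξ j * y j) *
        Real.exp (-t * (Real.sqrt (∑ j, ξ j ^ 2)) ^ α))) := by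
  have hs : ∀ ξ : Fin d → ℝ, Real.exp (-(t * (∑ j, ξ j ^ 2) ^ (α / 2))) =
      Real.exp (-t * (Real.sqrt (∑ j, ξ j ^ 2)) ^ α) := by
    intro ξ
    rw [Real.sqrt_eq_rpow, ← Real.rpow_mul (Finset.sum_nonneg fun j _ => sq_nonneg _)]
    ring_nf
  simp_rw [hs]
  have hc : Continuous fun ξ : Fin d → ℝ => (Real.sqrt (∑ j, ξ j ^ 2)) ^ α :=
      Continuous.rpow_const (by fun_prop) fun _ => Or.inr hα.le
  refine tendsto_integral_of_dominated_convergence _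
    (fun n => Continuous.aestronglyMeasurable (by fun_prop))
    (integrable_exp_neg_mul_sum_sqrt_rpow hd hα ht) (fun n => ?_) ?_
  · refine Filter.Eventually.of_forall fun ξ => ?_
    rw [norm_mul, norm_mul, Real.norm_eq_abs, Real.norm_eq_abs, Real.norm_eq_abs,
      Real.abs_exp, Real.abs_exp]
    have h1 : Real.exp (-((1 / ((n : ℝ) + 1)) * ∑ j, ξ j ^ 2)) ≤ 1 := by
      rw [Real.exp_le_one_iff, neg_nonpos]
      exact mul_nonneg (by positivity) (Finset.sum_nonneg fun j _ => sq_nonneg _)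
    refine (mul_le_of_le_one_left (by positivity) (Real.abs_cos_le_one _)).trans ?_
    exact mul_le_of_le_one_right (Real.exp_pos _).le h1
  · refine Filter.Eventually.of_forall fun ξ => ?_
    have h := ((tendsto_one_div_add_atTop_nhds_zero_nat (𝕜 := ℝ)).mul_const
      (∑ j, ξ j ^ 2)).neg.rexp
    rw [zero_mul, neg_zero, Real.exp_zero] at h
    have := (h.const_mul (Real.exp (-t * (Real.sqrt (∑ j, ξ j ^ 2)) ^ α))).const_mul
      (Real.cos (∑ j, ξ j * y j))
    rwa [mul_one] at this

lemma isUnimodalKernel_stableDensityD {d : ℕ} (hd : 0 < d) {α t : ℝ} (hα0 : 0 < α)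
    (hα2 : α ≤ 2) (ht : 0 < t) : IsUnimodalKernel (stableDensityD d α t) := by
  have hmix : ExpMixture (fun r => Real.exp (-(t * r ^ (α / 2)))) :=
    ExpMixture.exp_neg_rpow (by positivity) (by linarith) ht.le
  have hpos : ∀ n : ℕ, (0 : ℝ) < 1 / ((n : ℝ) + 1) := fun n => by positivity
  refine ⟨?_, fun y => ?_, fun y y' h => ?_⟩
  · refine continuous_const.mul (continuous_of_dominated (fun y => ?_) (fun y => ?_)
      (integrable_exp_neg_mul_sum_sqrt_rpow hd hα0 ht) ?_)
    · exact (Continuous.aestronglyMeasurable (by fun_prop)).mul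
        (integrable_exp_neg_mul_sum_sqrt_rpow hd hα0 ht).aestronglyMeasurable
    · refine Filter.Eventually.of_forall fun ξ => ?_
      rw [norm_mul, Real.norm_eq_abs, Real.norm_eq_abs, Real.abs_exp]
      exact mul_le_of_le_one_left (Real.exp_pos _).le (Real.abs_cos_le_one _)
    · refine Filter.Eventually.of_forall fun ξ => ?_
      fun_prop
  · exact mul_nonneg (by positivity) (ge_of_tendsto'
      (tendsto_integral_cos_mul_exp hd hα0 ht y) fun n =>
        (hmix.integral_cos_mul_anti hd (hpos n) le_rfl).1)
  · refine mul_le_mul_of_nonneg_left ?_ (by positivity)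
    exact le_of_tendsto_of_tendsto' (tendsto_integral_cos_mul_exp hd hα0 ht y')
      (tendsto_integral_cos_mul_exp hd hα0 ht y) fun n =>
        (hmix.integral_cos_mul_anti hd (hpos n)
          (Finset.sum_le_sum fun k _ => sq_le_sq.2 (h k))).2

/-- Even functions decreasing away from `0` whose reflected differences
`m ↦ φ (m - z) - φ (m + z)` are increasing on `[0, b]`. -/
structure IsMidShape (b : ℝ) (φ : ℝ → ℝ) : Prop where
  anti : ∀ s s', |s| ≤ |s'| → φ s' ≤ φ s
  diff : ∀ m m' z, 0 ≤ m → m ≤ m' → m' ≤ b → 0 ≤ z →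
    φ (m - z) - φ (m + z) ≤ φ (m' - z) - φ (m' + z)

namespace IsMidShape

lemma const (b c : ℝ) : IsMidShape b (fun _ => c) :=
  ⟨fun _ _ _ => le_rfl, fun _ _ _ _ _ _ _ => le_rfl⟩

lemma truncate {a : ℝ} {φ : ℝ → ℝ} (hφ : IsMidShape (a / 2) φ) (h0 : ∀ s, 0 ≤ φ s) :
    IsMidShape (a / 2) (fun s => if |s| < a then φ s else 0) := by
  have hanti : ∀ s s', |s| ≤ |s'| →
      (if |s'| < a then φ s' else 0) ≤ (if |s| < a then φ s else 0) := by
    intro s s' h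
    by_cases hs' : |s'| < a
    · rw [if_pos hs', if_pos (h.trans_lt hs')]
      exact hφ.anti s s' h
    · rw [if_neg hs']
      split_ifs
      exacts [h0 s, le_rfl]
  refine ⟨hanti, fun m m' z hm hmm hb hz => ?_⟩
  by_cases h : m' + z < a
  · rw [if_pos (abs_lt.2 ⟨by linarith, by linarith⟩), if_pos (abs_lt.2 ⟨by linarith, by linarith⟩),
      if_pos (abs_lt.2 ⟨by linarith, by linarith⟩), if_pos (abs_lt.2 ⟨by linarith, by linarith⟩)]
    exact hφ.diff m m' z hm hmm hb hz
  · have h1 := hanti (m' - z) (m - z) (by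
      rw [abs_of_nonpos (by linarith), abs_of_nonpos (by linarith)]
      linarith)
    have h2 : ¬ |m' + z| < a := by
      rw [abs_of_nonneg (by linarith)]
      exact h
    have h3 : (0 : ℝ) ≤ if |m + z| < a then φ (m + z) else 0 := by
      split_ifs
      exacts [h0 _, le_rfl]
    rw [if_neg h2]
    linarith

lemma even {b : ℝ} {φ : ℝ → ℝ} (hφ : IsMidShape b φ) (s : ℝ) : φ (-s) = φ s :=
  le_antisymm (hφ.anti _ _ (by rw [abs_neg])) (hφ.anti _ _ (by rw [abs_neg]))

lemma diff_neg {b : ℝ} {φ : ℝ → ℝ} (hφ : IsMidShape b φ) (m z : ℝ) :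
    φ (-m - z) - φ (-m + z) = -(φ (m - z) - φ (m + z)) := by
  rw [← hφ.even (m - z), ← hφ.even (m + z)]
  ring_nf

lemma diff_nonneg {b : ℝ} {φ : ℝ → ℝ} (hφ : IsMidShape b φ) {m z : ℝ} (hm : 0 ≤ m)
    (hz : 0 ≤ z) : 0 ≤ φ (m - z) - φ (m + z) :=
  sub_nonneg.2 (hφ.anti _ _ (by
    rw [abs_of_nonneg (by linarith : 0 ≤ m + z), abs_le]
    constructor <;> linarith))

lemma diff_le_diff {b : ℝ} {φ : ℝ → ℝ} (hφ : IsMidShape b φ) {m m' z : ℝ} (hm : -b ≤ m)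
    (hmm : m ≤ m') (hb : m' ≤ b) (hz : 0 ≤ z) :
    φ (m - z) - φ (m + z) ≤ φ (m' - z) - φ (m' + z) := by
  rcases le_total 0 m with h | h
  · exact hφ.diff m m' z h hmm hb hz
  · have e := hφ.diff_neg m z
    rcases le_total 0 m' with h' | h'
    · have := hφ.diff_nonneg (m := -m) (by linarith) hz
      have := hφ.diff_nonneg h' hz
      linarith
    · have e' := hφ.diff_neg m' z
      have := hφ.diff (-m') (-m) z (by linarith) (by linarith) (by linarith) hz
      linarith

end IsMidShape

/-- A continuous midpoint-concave function on an open interval is concave. -/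
lemma concaveOn_Ioo_of_midpoint_s8 {l u : ℝ} {φ : ℝ → ℝ} (hc : ContinuousOn φ (Set.Ioo l u))
    (hmid : ∀ p h, 0 < h → l < p - h → p + h < u → φ (p - h) + φ (p + h) ≤ 2 * φ p) :
    ConcaveOn ℝ (Set.Ioo l u) φ := by
  refine concaveOn_of_slope_anti_adjacent (convex_Ioo l u) ?_
  intro x y z hx hz hxy hyz
  set k := (φ z - φ x) / (z - x) with hk
  have hzx : 0 < z - x := by linarith
  have hk' : k * (z - x) = φ z - φ x := div_mul_cancel₀ _ hzx.ne'
  set g : ℝ → ℝ := fun s => φ s - (φ x + k * (s - x)) with hg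
  have hgx : g x = 0 := by simp [hg]
  have hgz : g z = 0 := by
    simp only [hg]
    linarith
  have hgc : ContinuousOn g (Set.Icc x z) :=
    (hc.mono fun s hs => ⟨hx.1.trans_le hs.1, hs.2.trans_lt hz.2⟩).sub (by fun_prop)
  obtain ⟨c, hcm, hmin⟩ := isCompact_Icc.exists_isMinOn ⟨x, le_rfl, by linarith⟩ hgc
  have hgy : 0 ≤ g y := by
    by_contra hneg
    have hcn : g c < 0 := lt_of_le_of_lt (hmin ⟨hxy.le, hyz.le⟩) (not_le.1 hneg)
    have hcx : x < c := lt_of_le_of_ne hcm.1 fun h => by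
      rw [← h, hgx] at hcn
      exact lt_irrefl _ hcn
    have hcz : c < z := lt_of_le_of_ne hcm.2 fun h => by
      rw [h, hgz] at hcn
      exact lt_irrefl _ hcn
    set h := min (c - x) (z - c) with hh
    have hpos : 0 < h := lt_min (by linarith) (by linarith)
    have hlx : h ≤ c - x := min_le_left _ _
    have hlz : h ≤ z - c := min_le_right _ _
    have h1 := hmid c h hpos (by linarith [hx.1]) (by linarith [hz.2])
    have h2 : g c ≤ g (c - h) := hmin ⟨by linarith, by linarith⟩
    have h3 : g c ≤ g (c + h) := hmin ⟨by linarith, by linarith⟩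
    have h4 : g (c - h) + g (c + h) ≤ 2 * g c := by
      simp only [hg]
      linarith
    rcases min_choice (c - x) (z - c) with h5 | h5
    · have : c - h = x := by
        rw [hh, h5]
        ring
      rw [this, hgx] at h4 h2
      linarith
    · have : c + h = z := by
        rw [hh, h5]
        ring
      rw [this, hgz] at h4 h3
      linarith
  simp only [hg] at hgy
  have h1 : k ≤ (φ y - φ x) / (y - x) := by
    rw [le_div_iff₀ (by linarith)]
    linarith
  have h2 : (φ z - φ y) / (z - y) ≤ k := by
    rw [div_le_iff₀ (by linarith)]
    linarith
  exact h2.trans h1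

lemma IsMidShape.concaveOn {b : ℝ} {φ : ℝ → ℝ} (hφ : IsMidShape b φ) (hc : Continuous φ) :
    ConcaveOn ℝ (Set.Ioo (-b) b) φ := by
  refine concaveOn_Ioo_of_midpoint_s8 hc.continuousOn fun p h hh hl hu => ?_
  have := hφ.diff_le_diff (m := p - h / 2) (m' := p + h / 2) (z := h / 2) (by linarith)
    (by linarith) (by linarith) (by linarith)
  ring_nf at this ⊢
  linarith

lemma IsMidShape.of_diff {b : ℝ} {φ : ℝ → ℝ} (heven : ∀ s, φ (-s) = φ s)
    (hnonneg : ∀ m z, 0 ≤ m → 0 ≤ z → 0 ≤ φ (m - z) - φ (m + z))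
    (hdiff : ∀ m m' z, 0 ≤ m → m ≤ m' → m' ≤ b → 0 ≤ z →
      φ (m - z) - φ (m + z) ≤ φ (m' - z) - φ (m' + z)) : IsMidShape b φ := by
  refine ⟨fun s s' h => ?_, hdiff⟩
  have habs : ∀ s, φ |s| = φ s := fun s => by
    rcases abs_choice s with h | h <;> rw [h]
    exact heven s
  rw [← habs s, ← habs s']
  have := hnonneg ((|s| + |s'|) / 2) ((|s'| - |s|) / 2) (by positivity) (by linarith)
  ring_nf at this
  linarith

section Convolution

variable {d : ℕ}

lemma measurePreserving_update_add (j : Fin d) (m : ℝ) :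
    MeasurePreserving (fun v : Fin d → ℝ => Function.update v j (m + v j)) := by
  have h := volume_preserving_pi (ι := Fin d) (α' := fun _ => ℝ) (β' := fun _ => ℝ)
    (f := fun k s => if k = j then m + s else s) (fun k => by
      by_cases hk : k = j
      · simpa [hk] using measurePreserving_add_left volume m
      · simp only [hk, if_false]
        exact MeasurePreserving.id volume)
  convert h using 1
  ext v k
  by_cases hk : k = j
  · subst hk; simp
  · simp [hk]

lemma measurePreserving_update_sub (j : Fin d) (m : ℝ) :
    MeasurePreserving (fun v : Fin d → ℝ => Function.update v j (m - v j)) := by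
  have h := volume_preserving_pi (ι := Fin d) (α' := fun _ => ℝ) (β' := fun _ => ℝ)
    (f := fun k s => if k = j then m - s else s) (fun k => by
      by_cases hk : k = j
      · simpa [hk] using Measure.measurePreserving_sub_left volume m
      · simp only [hk, if_false]
        exact MeasurePreserving.id volume)
  convert h using 1
  ext v k
  by_cases hk : k = j
  · subst hk; simp
  · simp [hk]

lemma integral_comp_of_measurePreserving {X : Type*} [MeasureSpace X] {T : X → X}
    (hT : MeasurePreserving T) {g : X → ℝ} (hg : Integrable g) :
    ∫ v, g (T v) = ∫ v, g v := by
  conv_rhs => rw [← hT.map_eq]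
  rw [integral_map hT.measurable.aemeasurable]
  rw [hT.map_eq]
  exact hg.aestronglyMeasurable

namespace IsUnimodalKernel

variable {q : (Fin d → ℝ) → ℝ}

lemma le_zero (hq : IsUnimodalKernel q) (y : Fin d → ℝ) : q y ≤ q 0 :=
  hq.anti 0 y fun k => by simp

lemma integrable_mul (hq : IsUnimodalKernel q) {f : (Fin d → ℝ) → ℝ} (hf : Integrable f)
    (x : Fin d → ℝ) : Integrable (fun y => q (x - y) * f y) := by
  refine hf.bdd_mul (c := q 0) ?_ (Filter.Eventually.of_forall fun y => ?_)
  · exact (hq.continuous.comp (by fun_prop)).aestronglyMeasurable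
  · rw [Real.norm_eq_abs, abs_of_nonneg (hq.nonneg _)]
    exact hq.le_zero _

lemma eq_of_abs_eq (hq : IsUnimodalKernel q) {y y' : Fin d → ℝ} (h : ∀ k, |y k| = |y' k|) :
    q y = q y' :=
  le_antisymm (hq.anti _ _ fun k => (h k).ge) (hq.anti _ _ fun k => (h k).le)

lemma convolution_diff (hq : IsUnimodalKernel q) {f : (Fin d → ℝ) → ℝ} (hf : Integrable f)
    (j : Fin d) (x : Fin d → ℝ) (m z : ℝ) :
    Integrable (fun v : Fin d → ℝ =>
      (q (Function.update (x - v) j (v j - z)) - q (Function.update (x - v) j (v j + z))) *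
        (f (Function.update v j (m - v j)) - f (Function.update v j (m + v j)))) ∧
    2 * ((∫ y, q (Function.update x j (m - z) - y) * f y) -
      ∫ y, q (Function.update x j (m + z) - y) * f y) =
    ∫ v : Fin d → ℝ,
      (q (Function.update (x - v) j (v j - z)) - q (Function.update (x - v) j (v j + z))) *
        (f (Function.update v j (m - v j)) - f (Function.update v j (m + v j))) := by
  have i1 := hq.integrable_mul hf (Function.update x j (m - z))
  have i2 := hq.integrable_mul hf (Function.update x j (m + z))
  have hS := measurePreserving_update_sub j m
  have hA := measurePreserving_update_add j m
  have j1 := (hS.integrable_comp i1.aestronglyMeasurable).2 i1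
  have j2 := (hA.integrable_comp i1.aestronglyMeasurable).2 i1
  have j3 := (hS.integrable_comp i2.aestronglyMeasurable).2 i2
  have j4 := (hA.integrable_comp i2.aestronglyMeasurable).2 i2
  have e1 := integral_comp_of_measurePreserving hS i1
  have e2 := integral_comp_of_measurePreserving hA i1
  have e3 := integral_comp_of_measurePreserving hS i2
  have e4 := integral_comp_of_measurePreserving hA i2
  have hpt : (fun v : Fin d → ℝ =>
      (q (Function.update (x - v) j (v j - z)) - q (Function.update (x - v) j (v j + z))) *
        (f (Function.update v j (m - v j)) - f (Function.update v j (m + v j)))) = fun v =>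
      ((q (Function.update x j (m - z) - Function.update v j (m - v j)) *
          f (Function.update v j (m - v j)) +
        q (Function.update x j (m - z) - Function.update v j (m + v j)) *
          f (Function.update v j (m + v j))) -
      (q (Function.update x j (m + z) - Function.update v j (m - v j)) *
          f (Function.update v j (m - v j)) +
        q (Function.update x j (m + z) - Function.update v j (m + v j)) *
          f (Function.update v j (m + v j)))) := by
    ext v
    have hcoord : ∀ s t w : ℝ, |s - t| = |w| →
        q (Function.update x j s - Function.update v j t) = q (Function.update (x - v) j w) := by
      intro s t w h
      refine hq.eq_of_abs_eq fun k => ?_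
      by_cases hk : k = j
      · subst hk
        simpa using h
      · simp [hk]
    rw [hcoord (m - z) (m - v j) (v j - z) (by ring_nf),
      hcoord (m - z) (m + v j) (v j + z) (by rw [← abs_neg]; ring_nf),
      hcoord (m + z) (m - v j) (v j + z) (by ring_nf),
      hcoord (m + z) (m + v j) (v j - z) (by rw [← abs_neg]; ring_nf)]
    ring
  constructor
  · rw [hpt]
    exact (j1.add j2).sub (j3.add j4)
  · rw [hpt]
    refine Eq.trans ?_ (integral_sub (j1.add j2) (j3.add j4)).symm
    refine Eq.trans ?_ (congrArg₂ (· - ·) (integral_add j1 j2) (integral_add j3 j4)).symm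
    simp only [Function.comp]
    rw [e1, e2, e3, e4]
    ring

lemma isMidShape_convolution (hq : IsUnimodalKernel q) {f : (Fin d → ℝ) → ℝ}
    (hf : Integrable f) {b : ℝ} {j : Fin d}
    (hshape : ∀ x, IsMidShape b (fun s => f (Function.update x j s))) (x : Fin d → ℝ) :
    IsMidShape b (fun s => ∫ y, q (Function.update x j s - y) * f y) := by
  have hK : ∀ (v : Fin d → ℝ) (z : ℝ), 0 ≤ z → 0 ≤ v j →
      0 ≤ q (Function.update (x - v) j (v j - z)) - q (Function.update (x - v) j (v j + z)) := by
    intro v z hz hv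
    refine sub_nonneg.2 (hq.anti _ _ fun k => ?_)
    by_cases hk : k = j
    · subst hk
      simp only [Function.update_self]
      rw [abs_of_nonneg (by linarith : 0 ≤ v k + z), abs_le]
      constructor <;> linarith
    · simp [hk]
  have hK' : ∀ (v : Fin d → ℝ) (z : ℝ), 0 ≤ z → v j ≤ 0 →
      q (Function.update (x - v) j (v j - z)) - q (Function.update (x - v) j (v j + z)) ≤ 0 := by
    intro v z hz hv
    refine sub_nonpos.2 (hq.anti _ _ fun k => ?_)
    by_cases hk : k = j
    · subst hk
      simp only [Function.update_self]
      rw [abs_of_nonpos (by linarith : v k - z ≤ 0), abs_le]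
      constructor <;> linarith
    · simp [hk]
  refine IsMidShape.of_diff (fun s => ?_) (fun m z hm hz => ?_) fun m m' z hm hmm hb hz => ?_
  · have h := (hq.convolution_diff hf j x 0 s).2
    have h0 : ∀ v : Fin d → ℝ, f (Function.update v j (0 - v j)) -
        f (Function.update v j (0 + v j)) = 0 := fun v => by
      rw [zero_sub, zero_add, sub_eq_zero]
      exact (hshape v).even (v j)
    simp only [h0, mul_zero, integral_zero] at h
    rw [zero_sub, zero_add] at h
    linarith
  · have h := (hq.convolution_diff hf j x m z).2
    have : 0 ≤ ∫ v : Fin d → ℝ,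
      (q (Function.update (x - v) j (v j - z)) - q (Function.update (x - v) j (v j + z))) *
        (f (Function.update v j (m - v j)) - f (Function.update v j (m + v j))) := by
      refine integral_nonneg fun v => ?_
      rcases le_total 0 (v j) with hv | hv
      · exact mul_nonneg (hK v z hz hv) ((hshape v).diff_nonneg hm hv)
      · have := (hshape v).diff_nonneg hm (neg_nonneg.2 hv)
        rw [sub_neg_eq_add, ← sub_eq_add_neg] at this
        exact mul_nonneg_of_nonpos_of_nonpos (hK' v z hz hv) (by linarith)
    linarith
  · have h := hq.convolution_diff hf j x m z
    have h' := hq.convolution_diff hf j x m' z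
    have := integral_mono h.1 h'.1 fun v => by
      rcases le_total 0 (v j) with hv | hv
      · exact mul_le_mul_of_nonneg_left ((hshape v).diff m m' _ hm hmm hb hv) (hK v z hz hv)
      · have h2 := (hshape v).diff m m' _ hm hmm hb (neg_nonneg.2 hv)
        simp only [sub_neg_eq_add, ← sub_eq_add_neg] at h2
        exact mul_le_mul_of_nonpos_left (by linarith) (hK' v z hz hv)
    linarith [h.2, h'.2]

lemma continuous_convolution (hq : IsUnimodalKernel q) {f : (Fin d → ℝ) → ℝ}
    (hf : Integrable f) : Continuous (fun x => ∫ y, q (x - y) * f y) := by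
  refine continuous_of_dominated (bound := fun y => q 0 * ‖f y‖)
    (fun x => (hq.integrable_mul hf x).aestronglyMeasurable) (fun x => ?_)
    (hf.norm.const_mul _) (Filter.Eventually.of_forall fun y => ?_)
  · refine Filter.Eventually.of_forall fun y => ?_
    rw [norm_mul, Real.norm_eq_abs, abs_of_nonneg (hq.nonneg _)]
    exact mul_le_mul_of_nonneg_right (hq.le_zero _) (norm_nonneg _)
  · exact (hq.continuous.comp (by fun_prop)).mul continuous_const

end IsUnimodalKernel

/-- The open rectangle with half side lengths `a`. -/
def openBox (a : Fin d → ℝ) : Set (Fin d → ℝ) :=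
  Set.univ.pi fun j => Set.Ioo (-(a j)) (a j)

lemma measurableSet_openBox (a : Fin d → ℝ) : MeasurableSet (openBox a) :=
  MeasurableSet.univ_pi fun _ => measurableSet_Ioo

instance isFiniteMeasure_restrict_openBox (a : Fin d → ℝ) :
    IsFiniteMeasure ((volume : Measure (Fin d → ℝ)).restrict (openBox a)) := by
  refine ⟨?_⟩
  rw [Measure.restrict_apply_univ]
  refine (measure_mono (t := Set.Icc (fun j => -(a j)) a) fun y hy => ?_).trans_lt
    isCompact_Icc.measure_lt_top
  exact ⟨fun j => (hy j trivial).1.le, fun j => (hy j trivial).2.le⟩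

/-- The iterated integral over the rectangle of a chain of convolution kernels. -/
noncomputable def chainIntegral (a : Fin d → ℝ) (n : ℕ) (q : Fin n → (Fin d → ℝ) → ℝ)
    (x : Fin d → ℝ) : ℝ :=
  ∫ y : Fin n → Fin d → ℝ, ∏ i : Fin n,
    q i ((Fin.cons x y : Fin (n + 1) → Fin d → ℝ) i.castSucc -
      (Fin.cons x y : Fin (n + 1) → Fin d → ℝ) i.succ)
    ∂(Measure.pi fun _ : Fin n => (volume : Measure (Fin d → ℝ)).restrict (openBox a))

lemma continuous_chain {n : ℕ} {q : Fin n → (Fin d → ℝ) → ℝ}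
    (hq : ∀ i, IsUnimodalKernel (q i)) : Continuous fun p : (Fin d → ℝ) × (Fin n → Fin d → ℝ) =>
      ∏ i : Fin n, q i ((Fin.cons p.1 p.2 : Fin (n + 1) → Fin d → ℝ) i.castSucc -
        (Fin.cons p.1 p.2 : Fin (n + 1) → Fin d → ℝ) i.succ) := by
  have hcons : ∀ k : Fin (n + 1), Continuous fun p : (Fin d → ℝ) × (Fin n → Fin d → ℝ) =>
      (Fin.cons p.1 p.2 : Fin (n + 1) → Fin d → ℝ) k := by
    intro k
    refine Fin.cases ?_ (fun i => ?_) k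
    · simpa using continuous_fst
    · simp only [Fin.cons_succ]
      fun_prop
  exact continuous_finsetProd _ fun i _ =>
    (hq i).continuous.comp ((hcons _).sub (hcons _))

lemma chainIntegral_succ (a : Fin d → ℝ) {n : ℕ} {q : Fin (n + 1) → (Fin d → ℝ) → ℝ}
    (hq : ∀ i, IsUnimodalKernel (q i)) (x : Fin d → ℝ) :
    chainIntegral a (n + 1) q x = ∫ y, q 0 (x - y) *
      (openBox a).indicator (chainIntegral a n fun i => q i.succ) y := by
  set μ := (volume : Measure (Fin d → ℝ)).restrict (openBox a) with hμ
  have hmp := (measurePreserving_piFinSuccAbove (fun _ : Fin (n + 1) => μ) 0).symm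
  have hval : ∀ p : (Fin d → ℝ) × (Fin n → Fin d → ℝ),
      (∏ i : Fin (n + 1), q i ((Fin.cons x ((MeasurableEquiv.piFinSuccAbove
        (fun _ : Fin (n + 1) => Fin d → ℝ) 0).symm p) : Fin (n + 2) → Fin d → ℝ) i.castSucc -
        (Fin.cons x ((MeasurableEquiv.piFinSuccAbove
          (fun _ : Fin (n + 1) => Fin d → ℝ) 0).symm p) : Fin (n + 2) → Fin d → ℝ) i.succ)) =
      q 0 (x - p.1) * ∏ i : Fin n, q i.succ
        ((Fin.cons p.1 p.2 : Fin (n + 1) → Fin d → ℝ) i.castSucc -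
          (Fin.cons p.1 p.2 : Fin (n + 1) → Fin d → ℝ) i.succ) := by
    intro p
    have hp : (MeasurableEquiv.piFinSuccAbove (fun _ : Fin (n + 1) => Fin d → ℝ) 0).symm p =
        Fin.cons p.1 p.2 := by
      simp [MeasurableEquiv.piFinSuccAbove, Fin.insertNthEquiv]
    rw [hp, Fin.prod_univ_succ]
    simp only [Fin.cons_succ, Fin.castSucc_zero, Fin.cons_zero, ← Fin.succ_castSucc]
  have hint : Integrable (fun p : (Fin d → ℝ) × (Fin n → Fin d → ℝ) =>
      q 0 (x - p.1) * ∏ i : Fin n, q i.succ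
        ((Fin.cons p.1 p.2 : Fin (n + 1) → Fin d → ℝ) i.castSucc -
          (Fin.cons p.1 p.2 : Fin (n + 1) → Fin d → ℝ) i.succ))
      (μ.prod (Measure.pi fun _ : Fin n => μ)) := by
    refine Integrable.of_bound (C := q 0 0 * ∏ i : Fin n, q i.succ 0) ?_
      (Filter.Eventually.of_forall fun p => ?_)
    · exact (((hq 0).continuous.comp (by fun_prop)).mul
        (continuous_chain fun i => hq i.succ)).aestronglyMeasurable
    · have h1 : ∀ i : Fin n, 0 ≤ q i.succ
        ((Fin.cons p.1 p.2 : Fin (n + 1) → Fin d → ℝ) i.castSucc -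
          (Fin.cons p.1 p.2 : Fin (n + 1) → Fin d → ℝ) i.succ) := fun i => (hq _).nonneg _
      rw [Real.norm_eq_abs, abs_of_nonneg (mul_nonneg ((hq 0).nonneg _)
        (Finset.prod_nonneg fun i _ => h1 i))]
      exact mul_le_mul ((hq 0).le_zero _)
        (Finset.prod_le_prod (fun i _ => h1 i) fun i _ => (hq _).le_zero _)
        (Finset.prod_nonneg fun i _ => h1 i) ((hq 0).nonneg _)
  rw [chainIntegral, ← hmp.integral_comp']
  simp_rw [hval]
  have hprod := integral_prod _ hint
  refine hprod.trans ?_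
  simp_rw [integral_const_mul]
  rw [hμ, ← integral_indicator (measurableSet_openBox a)]
  refine integral_congr_ae (Filter.Eventually.of_forall fun y => ?_)
  by_cases hy : y ∈ openBox a
  · simp only [Set.indicator_of_mem hy]
    rfl
  · simp only [Set.indicator_of_notMem hy, mul_zero]

lemma isMidShape_indicator_openBox {a : Fin d → ℝ} {u : (Fin d → ℝ) → ℝ} (h0 : ∀ x, 0 ≤ u x)
    {j : Fin d} (hu : ∀ x, IsMidShape (a j / 2) (fun s => u (Function.update x j s)))
    (x : Fin d → ℝ) :
    IsMidShape (a j / 2) (fun s => (openBox a).indicator u (Function.update x j s)) := by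
  by_cases hx : ∀ k, k ≠ j → x k ∈ Set.Ioo (-(a k)) (a k)
  · convert (hu x).truncate fun s => h0 _ using 2 with s
    by_cases hs : |s| < a j
    · rw [if_pos hs, Set.indicator_of_mem]
      intro k _
      by_cases hk : k = j
      · subst hk
        simpa using abs_lt.1 hs
      · simpa [hk] using hx k hk
    · rw [if_neg hs, Set.indicator_of_notMem]
      intro hmem
      have := hmem j trivial
      rw [Function.update_self] at this
      exact hs (abs_lt.2 this)
  · convert IsMidShape.const (a j / 2) 0 using 2 with s
    rw [Set.indicator_of_notMem]
    intro hmem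
    refine hx fun k hk => ?_
    have := hmem k trivial
    rwa [Function.update_of_ne hk] at this

lemma chainIntegral_shape (a : Fin d → ℝ) {n : ℕ} {q : Fin n → (Fin d → ℝ) → ℝ}
    (hq : ∀ i, IsUnimodalKernel (q i)) :
    Continuous (chainIntegral a n q) ∧ (∀ x, 0 ≤ chainIntegral a n q x) ∧
      ∀ j x, IsMidShape (a j / 2) (fun s => chainIntegral a n q (Function.update x j s)) := by
  induction n with
  | zero =>
    have : chainIntegral a 0 q = fun _ => chainIntegral a 0 q 0 := by
      ext x
      simp [chainIntegral]
    refine ⟨?_, fun x => ?_, fun j x => ?_⟩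
    · rw [this]
      exact continuous_const
    · exact integral_nonneg fun y => Finset.prod_nonneg fun i _ => (hq i).nonneg _
    · rw [this]
      exact IsMidShape.const _ _
  | succ n ih =>
    obtain ⟨hc, h0, hs⟩ := ih fun i => hq i.succ
    have hint : Integrable ((openBox a).indicator (chainIntegral a n fun i => q i.succ)) := by
      refine (integrable_indicator_iff (measurableSet_openBox a)).2 ?_
      refine (hc.continuousOn.integrableOn_compact
        (isCompact_Icc (a := fun j => -(a j)) (b := a))).mono_set fun y hy => ?_
      exact ⟨fun j => (hy j trivial).1.le, fun j => (hy j trivial).2.le⟩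
    have heq := funext (chainIntegral_succ a hq)
    refine ⟨?_, fun x => ?_, fun j x => ?_⟩
    · rw [heq]
      exact (hq 0).continuous_convolution hint
    · exact integral_nonneg fun y => Finset.prod_nonneg fun i _ => (hq i).nonneg _
    · rw [heq]
      exact (hq 0).isMidShape_convolution hint (isMidShape_indicator_openBox h0 (hs j)) x

end Convolution

lemma stableFDDd_eq_chainIntegral (d n : ℕ) (α : ℝ) (a : Fin d → ℝ) (t : Fin n → ℝ) :
    stableFDDd d n α a t = chainIntegral a n fun i => stableDensityD d α
      ((Fin.cons 0 t : Fin (n + 1) → ℝ) i.succ - (Fin.cons 0 t : Fin (n + 1) → ℝ) i.castSucc) := by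
  ext x
  have hset : {y : Fin n → Fin d → ℝ | ∀ i j, y i j ∈ Set.Ioo (-(a j)) (a j)} =
      Set.univ.pi fun _ => openBox a := by
    ext y
    simp [openBox, Set.mem_pi]
  rw [stableFDDd, chainIntegral, hset, volume_pi, Measure.restrict_pi_pi]

lemma fin_cons_increment_pos {n : ℕ} {t : Fin n → ℝ} (ht : ∀ i, 0 < t i) (htm : StrictMono t)
    (i : Fin n) :
    0 < (Fin.cons 0 t : Fin (n + 1) → ℝ) i.succ -
      (Fin.cons 0 t : Fin (n + 1) → ℝ) i.castSucc := by
  have hmono : StrictMono (Fin.cons 0 t : Fin (n + 1) → ℝ) := by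
    refine Fin.strictMono_iff_lt_succ.2 fun i => ?_
    cases n with
    | zero => exact i.elim0
    | succ n =>
      refine Fin.cases ?_ (fun k => ?_) i
      · simpa using ht 0
      · rw [← Fin.succ_castSucc, Fin.cons_succ, Fin.cons_succ]
        exact htm Fin.castSucc_lt_succ
  exact sub_pos.2 (hmono Fin.castSucc_lt_succ)

/-- `F` is mid-concave on `Q`: in each coordinate direction, with the other coordinates fixed
inside the rectangle, it is concave on the middle half, nondecreasing on `(-a_j, 0)` and
nonincreasing on `(0, a_j)` (equivalently `∂F/∂x_j ≥ 0` for `x_j < 0` and `∂F/∂x_j ≤ 0`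
for `x_j > 0`). -/
theorem stable_fdd_d_mid_concave (d : ℕ) (hd : 0 < d) (n : ℕ) (hn : 0 < n)
    (α : ℝ) (hα0 : 0 < α) (hα2 : α ≤ 2)
    (a : Fin d → ℝ) (ha : ∀ j, 0 < a j)
    (t : Fin n → ℝ) (ht : ∀ i, 0 < t i) (htm : StrictMono t)
    (j : Fin d) (x : Fin d → ℝ)
    (hx : ∀ k, k ≠ j → x k ∈ Set.Ioo (-(a k)) (a k)) :
    ConcaveOn ℝ (Set.Ioo (-(a j / 2)) (a j / 2))
      (fun s => stableFDDd d n α a t (Function.update x j s)) ∧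
    MonotoneOn (fun s => stableFDDd d n α a t (Function.update x j s))
      (Set.Ioo (-(a j)) (0 : ℝ)) ∧
    AntitoneOn (fun s => stableFDDd d n α a t (Function.update x j s))
      (Set.Ioo (0 : ℝ) (a j)) := by
  have hshape := chainIntegral_shape a fun i =>
    isUnimodalKernel_stableDensityD hd hα0 hα2 (fin_cons_increment_pos ht htm i)
  rw [← stableFDDd_eq_chainIntegral] at hshape
  obtain ⟨hc, -, hs⟩ := hshape
  have hsj := hs j x
  refine ⟨hsj.concaveOn (hc.comp (by fun_prop)), fun s hs s' hs' hss => ?_,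
    fun s hs s' hs' hss => ?_⟩
  · refine hsj.anti _ _ ?_
    rw [abs_of_neg hs.2, abs_of_neg hs'.2]
    exact neg_le_neg hss
  · refine hsj.anti _ _ ?_
    rwa [abs_of_pos hs.1, abs_of_pos hs'.1]
end
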